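/- Let G be a finite nonabelian group that is minimally faithful of degree 3, and suppose the Sylow 2-subgroup of the commutator subgroup [G,G] is nontrivial and cyclic. Then one of the following holds: (i) G is a 2-group; (ii) G is isomorphic to Q_8 × C_p × C_p for some odd prime p; (iii) there exist an odd prime p and k ≥ 2 such that G is isomorphic to (C_{2^k} ⋊ C_2) × C_p × C_p, where the generator of C_2 acts on C_{2^k} by g ↦ g^{1+2^{k-1}}. -/

import Mathlib

/-- `rdim G` is the smallest `n` such that `G` has a faithful `n`-dimensional
complex representation, i.e. an injective group homomorphism `G →* GL n ℂ`. -/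
noncomputable def rdim (G : Type*) [Group G] : ℕ :=
  sInf {n : ℕ | ∃ ρ : G →* GL (Fin n) ℂ, Function.Injective ρ}

/-- `G` is minimally faithful of degree `n` if `rdim G = n` and every proper
subgroup has strictly smaller representation dimension. -/
def MinFaithful (G : Type*) [Group G] (n : ℕ) : Prop :=
  rdim G = n ∧ ∀ H : Subgroup G, H ≠ ⊤ → rdim H < n


theorem cent2 (A X Y : Matrix (Fin 2) (Fin 2) ℂ) (hA : ∀ c : ℂ, A ≠ Matrix.scalar (Fin 2) c)
    (hX : A * X = X * A) (hY : A * Y = Y * A) : X * Y = Y * X := by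
  have h00 := congrFun (congrFun hX 0) 0
  have h01 := congrFun (congrFun hX 0) 1
  have h10 := congrFun (congrFun hX 1) 0
  have k00 := congrFun (congrFun hY 0) 0
  have k01 := congrFun (congrFun hY 0) 1
  have k10 := congrFun (congrFun hY 1) 0
  simp only [Matrix.mul_apply, Fin.sum_univ_two] at h00 h01 h10 k00 k01 k10
  have key : A 0 1 ≠ 0 ∨ A 1 0 ≠ 0 ∨ A 0 0 - A 1 1 ≠ 0 := by
    by_contra! hc
    apply hA (A 0 0)
    ext i j
    fin_cases i <;> fin_cases j <;> simp [hc.1, hc.2.1]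
    linear_combination - hc.2.2
  ext i j
  rcases key with h | h | h <;> apply mul_left_cancel₀ h <;>
  fin_cases i <;> fin_cases j <;> simp [Matrix.mul_apply, Fin.sum_univ_two] <;> grind

theorem odd_SL2_comm {H : Type*} [Group H] [Finite H]
    (σ : H →* Matrix (Fin 2) (Fin 2) ℂ) (hdet : ∀ g, (σ g).det = 1)
    (hodd : Odd (Nat.card H)) (a b : H) : σ a * σ b = σ b * σ a := by
  classical
  have := Fintype.ofFinite H
  by_contra hne
  have hsc : ∀ A : Matrix (Fin 2) (Fin 2) ℂ, (∀ h, A * σ h = σ h * A) →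
      ∃ c : ℂ, A = Matrix.scalar (Fin 2) c := by
    intro A hA
    by_contra! hc
    exact hne (cent2 A _ _ hc (hA a) (hA b))
  have hcard : (Fintype.card H : ℂ) ≠ 0 := by
    simp
  -- the sum vanishes
  have hl : ∀ h, σ h * ∑ g, σ g = ∑ g, σ g := by
    intro h
    rw [Finset.mul_sum]
    simp_rw [← map_mul]
    exact Fintype.sum_equiv (Equiv.mulLeft h) _ _ (fun _ => rfl)
  have hr : ∀ h, (∑ g, σ g) * σ h = ∑ g, σ g := by
    intro h
    rw [Finset.sum_mul]
    simp_rw [← map_mul]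
    exact Fintype.sum_equiv (Equiv.mulRight h) _ _ (fun _ => rfl)
  have hP : ∑ g, σ g = 0 := by
    obtain ⟨c, hc⟩ := hsc (∑ g, σ g) (fun h => by rw [hl, hr])
    by_cases c0 : c = 0
    · rw [hc, c0, map_zero]
    · exfalso
      apply hne
      have h1 : ∀ h, σ h = 1 := by
        intro h
        have := hl h
        rw [hc] at this
        have h2 : (Matrix.scalar (Fin 2) c) * Matrix.scalar (Fin 2) c⁻¹ = 1 := by
          rw [← map_mul, mul_inv_cancel₀ c0, map_one]
        calc σ h = σ h * ((Matrix.scalar (Fin 2) c) * Matrix.scalar (Fin 2) c⁻¹) := by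
              rw [h2, mul_one]
          _ = 1 := by rw [← mul_assoc, this, h2]
      rw [h1, h1]
  have hsq : ∑ g, σ (g ^ 2) = 0 := by
    rw [← hP]
    have hc : (Nat.card H).Coprime 2 := hodd.coprime_two_right
    exact Fintype.sum_equiv (powCoprime hc) _ _ (fun _ => rfl)
  have hCH : ∀ g, σ (g ^ 2) = (σ g).trace • σ g - 1 := by
    intro g
    have hd := hdet g
    rw [Matrix.det_fin_two] at hd
    rw [map_pow, pow_two]
    ext i j
    fin_cases i <;> fin_cases j <;>
      simp [Matrix.mul_apply, Fin.sum_univ_two, Matrix.trace] <;> grind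
  have hinv : ∀ g, σ g⁻¹ = (σ g).trace • 1 - σ g := by
    intro g
    have h1 : σ g * σ g⁻¹ = 1 := by rw [← map_mul, mul_inv_cancel, map_one]
    have h2 : ((σ g).trace • 1 - σ g) * σ g = 1 := by
      have := hCH g
      rw [map_pow, pow_two] at this
      rw [sub_mul, this]
      simp
    calc σ g⁻¹ = (((σ g).trace • 1 - σ g) * σ g) * σ g⁻¹ := by rw [h2, one_mul]
      _ = _ := by rw [mul_assoc, h1, mul_one]
  have htr : ∀ g, (σ g⁻¹).trace = (σ g).trace := by
    intro g
    rw [hinv]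
    simp [Matrix.trace, Fin.sum_univ_two]
    ring
  have e1 : ∑ g, (σ g).trace * (σ g).trace = 2 * (Fintype.card H : ℂ) := by
    have : ∑ g, ((σ g).trace • σ g - 1) = 0 := by
      rw [← hsq]; exact Finset.sum_congr rfl (fun g _ => (hCH g).symm)
    have h2 := congrArg Matrix.trace this
    rw [Matrix.trace_sum] at h2
    simp only [Matrix.trace_sub, Matrix.trace_smul, smul_eq_mul, Matrix.trace_one,
      Finset.sum_sub_distrib, Finset.sum_const, Matrix.trace_zero] at h2
    simp at h2
    linear_combination h2
  -- averaging operators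
  have hav : ∀ X : Matrix (Fin 2) (Fin 2) ℂ, ∑ g, σ g * X * σ g⁻¹ =
      Matrix.scalar (Fin 2) ((Fintype.card H : ℂ) * X.trace / 2) := by
    intro X
    obtain ⟨c, hc⟩ := hsc (∑ g, σ g * X * σ g⁻¹) (by
      intro h
      rw [Finset.sum_mul, Finset.mul_sum]
      refine Fintype.sum_equiv (Equiv.mulLeft h⁻¹) _ _ (fun g => ?_)
      simp only [Equiv.coe_mulLeft, mul_inv_rev, inv_inv, map_mul]
      have : σ h * σ h⁻¹ = 1 := by rw [← map_mul, mul_inv_cancel, map_one]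
      simp only [← mul_assoc]
      rw [this, one_mul])
    have h2 := congrArg Matrix.trace hc
    rw [Matrix.trace_sum] at h2
    have h3 : ∀ g, (σ g * X * σ g⁻¹).trace = X.trace := by
      intro g
      rw [Matrix.trace_mul_comm, ← mul_assoc, ← map_mul, inv_mul_cancel, map_one, one_mul]
    simp only [h3] at h2
    simp [Matrix.trace, Fin.sum_univ_two] at h2
    rw [hc]
    congr 1
    simp [Matrix.trace, Fin.sum_univ_two]
    linear_combination - h2 / 2
  have e2 : ∑ g, (σ g).trace * (σ g⁻¹).trace = (Fintype.card H : ℂ) := by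
    have h3 : ∀ i j : Fin 2, ∑ g, σ g i i * σ g⁻¹ j j =
        Matrix.scalar (Fin 2) ((Fintype.card H : ℂ) * (Matrix.single i j (1 : ℂ)).trace / 2) i j := by
      intro i j
      rw [← hav, Matrix.sum_apply]
      refine Finset.sum_congr rfl (fun g _ => ?_)
      simp [Matrix.mul_apply, Matrix.single_apply, Finset.sum_mul]
      fin_cases i <;> fin_cases j <;> simp
    have h4 : ∀ g, (σ g).trace * (σ g⁻¹).trace = σ g 0 0 * σ g⁻¹ 0 0 + σ g 0 0 * σ g⁻¹ 1 1
        + σ g 1 1 * σ g⁻¹ 0 0 + σ g 1 1 * σ g⁻¹ 1 1 := by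
      intro g
      simp [Matrix.trace, Fin.sum_univ_two]
      ring
    simp_rw [h4, Finset.sum_add_distrib, h3]
    simp [Matrix.trace, Fin.sum_univ_two]
  simp_rw [htr, e1] at e2
  apply hcard
  linear_combination e2

theorem odd_GL2_comm {H : Type*} [Group H] [Finite H]
    (ρ : H →* GL (Fin 2) ℂ) (hinj : Function.Injective ρ)
    (hodd : Odd (Nat.card H)) (a b : H) : a * b = b * a := by
  obtain ⟨m, hm⟩ := hodd
  let δ : H →* ℂˣ := (powMonoidHom (m + 1)).comp (Matrix.GeneralLinearGroup.det.comp ρ)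
  have hδ : ∀ g, (δ g) ^ 2 = Matrix.GeneralLinearGroup.det (ρ g) := by
    intro g
    have h1 : g ^ (2 * m + 1) = 1 := by rw [← hm]; exact pow_card_eq_one'
    have h2 : (Matrix.GeneralLinearGroup.det (ρ g)) ^ (2 * m + 1) = 1 := by
      rw [← map_pow, ← map_pow, h1, map_one, map_one]
    simp only [δ, MonoidHom.comp_apply, powMonoidHom_apply]
    rw [← pow_mul]
    calc _ = (Matrix.GeneralLinearGroup.det (ρ g)) ^ (2 * m + 1) *
          (Matrix.GeneralLinearGroup.det (ρ g)) := by rw [← pow_succ]; congr 1; ring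
      _ = _ := by rw [h2, one_mul]
  let σ : H →* Matrix (Fin 2) (Fin 2) ℂ :=
    { toFun := fun g => ((δ g)⁻¹ : ℂˣ).val • (ρ g).val
      map_one' := by simp
      map_mul' := by
        intro x y
        simp [smul_smul, mul_comm] }
  have hσ : ∀ g, σ g = ((δ g)⁻¹ : ℂˣ).val • (ρ g).val := fun g => rfl
  have hdet : ∀ g, (σ g).det = 1 := by
    intro g
    rw [hσ, Matrix.det_smul]
    have := congrArg Units.val (hδ g)
    simp at this
    simp [← this]
  have key := odd_SL2_comm σ hdet ⟨m, hm⟩ a b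
  apply hinj
  ext1
  rw [hσ, hσ] at key
  simp only [smul_mul_smul_comm] at key
  rw [mul_comm ((δ b)⁻¹ : ℂˣ).val] at key
  have hu : (((δ a)⁻¹ : ℂˣ).val * ((δ b)⁻¹ : ℂˣ).val) ≠ 0 := by simp
  have := smul_right_injective _ hu key
  simpa using this


/-- The homomorphism from `C_n` sending the generator to `x`. -/
noncomputable def pwHom {G : Type*} [Group G] (n : ℕ) (x : G) (h : x ^ n = 1) :
    Multiplicative (ZMod n) →* G :=
  AddMonoidHom.toMultiplicativeLeft (ZMod.lift n ⟨zmultiplesHom (Additive G) (Additive.ofMul x), by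
    simp [← ofMul_pow, h]⟩)

theorem pwHom_apply {G : Type*} [Group G] (n : ℕ) (x : G) (h : x ^ n = 1) (i : ℤ) :
    pwHom n x h (Multiplicative.ofAdd (i : ZMod n)) = x ^ i := by
  simp [pwHom, ← ofMul_zpow]

theorem pwHom_one {G : Type*} [Group G] (n : ℕ) (x : G) (h : x ^ n = 1) :
    pwHom n x h (Multiplicative.ofAdd 1) = x := by
  have := pwHom_apply n x h 1
  simpa using this

theorem zmod2_cases (g : Multiplicative (ZMod 2)) : g = 1 ∨ g = Multiplicative.ofAdd 1 := by
  revert g; decide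

theorem M_iso {S : Type*} [Group S] [Finite S] (a b : S) (k : ℕ) (hk : 2 ≤ k)
    (ha : a ^ (2 ^ k) = 1) (hb : b ^ 2 = 1) (hab : b * a * b⁻¹ = a ^ (1 + 2 ^ (k - 1)))
    (hgen : ∀ K : Subgroup S, a ∈ K → b ∈ K → K = ⊤) (hcard : Nat.card S = 2 * 2 ^ k) :
    ∃ φ : Multiplicative (ZMod 2) →* MulAut (Multiplicative (ZMod (2 ^ k))),
        (∀ g : Multiplicative (ZMod (2 ^ k)),
          φ (Multiplicative.ofAdd 1) g = g ^ (1 + 2 ^ (k - 1))) ∧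
        Nonempty (S ≃* (Multiplicative (ZMod (2 ^ k)) ⋊[φ] Multiplicative (ZMod 2))) := by
  have hpow : ∀ g : Multiplicative (ZMod (2 ^ k)), (g ^ (1 + 2 ^ (k - 1))) ^ (1 + 2 ^ (k - 1)) = g := by
    intro g
    have h1 : g ^ (2 ^ k) = 1 := by
      have h2 : Nat.card (Multiplicative (ZMod (2 ^ k))) = 2 ^ k := by simp
      have h3 : g ^ Nat.card (Multiplicative (ZMod (2 ^ k))) = 1 := pow_card_eq_one'
      exact (congrArg (fun n : ℕ => g ^ n) h2).symm.trans h3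
    obtain ⟨m, rfl⟩ : ∃ m, k = m + 2 := ⟨k - 2, by omega⟩
    have h4 : (1 + 2 ^ (m + 2 - 1)) * (1 + 2 ^ (m + 2 - 1)) = 1 + 2 ^ (m + 2) * (1 + 2 ^ m) := by
      have : m + 2 - 1 = m + 1 := by omega
      rw [this]; ring
    calc _ = g ^ ((1 + 2 ^ (m + 2 - 1)) * (1 + 2 ^ (m + 2 - 1))) := (pow_mul _ _ _).symm
      _ = g ^ (1 + 2 ^ (m + 2) * (1 + 2 ^ m)) := congrArg (fun n : ℕ => g ^ n) h4
      _ = g * (g ^ (2 ^ (m + 2))) ^ (1 + 2 ^ m) := 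
        (pow_add _ _ _).trans (by rw [pow_one]; exact congrArg _ (pow_mul _ _ _))
      _ = g * 1 ^ (1 + 2 ^ m) := congrArg (fun y => g * y ^ (1 + 2 ^ m)) h1
      _ = g := by rw [one_pow, mul_one]
  let α : MulAut (Multiplicative (ZMod (2 ^ k))) :=
    { toFun := fun g => g ^ (1 + 2 ^ (k - 1))
      invFun := fun g => g ^ (1 + 2 ^ (k - 1))
      left_inv := hpow
      right_inv := hpow
      map_mul' := fun x y => mul_pow x y _ }
  have hα : α ^ 2 = 1 := by
    ext1 g
    rw [pow_two]
    exact hpow g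
  let φ := pwHom 2 α hα
  have hφ : φ (Multiplicative.ofAdd 1) = α := pwHom_one 2 α hα
  have hconj : ∀ n : Multiplicative (ZMod (2 ^ k)),
      pwHom (2 ^ k) a ha (n ^ (1 + 2 ^ (k - 1))) = b * pwHom (2 ^ k) a ha n * b⁻¹ := by
    intro n
    obtain ⟨i, rfl⟩ : ∃ i : ℤ, n = Multiplicative.ofAdd (i : ZMod (2 ^ k)) :=
      ⟨(ZMod.cast n.toAdd : ℤ), by simp⟩
    rw [map_pow, pwHom_apply, ← conj_zpow, hab]
    simp only [← zpow_natCast, ← zpow_mul]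
    rw [mul_comm]
  refine ⟨φ, fun g => by rw [hφ]; rfl, ?_⟩
  let F : (Multiplicative (ZMod (2 ^ k)) ⋊[φ] Multiplicative (ZMod 2)) →* S :=
    SemidirectProduct.lift (pwHom (2 ^ k) a ha) (pwHom 2 b hb) (by
      intro g
      rcases zmod2_cases g with rfl | rfl
      · ext; simp
      · rw [hφ]
        refine MonoidHom.ext fun n => ?_
        rw [pwHom_one]
        exact hconj n)
  have hsurj : Function.Surjective F := by
    rw [← MonoidHom.range_eq_top]
    apply hgen
    · exact ⟨SemidirectProduct.inl (Multiplicative.ofAdd 1), by simp [F, pwHom_one]⟩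
    · exact ⟨SemidirectProduct.inr (Multiplicative.ofAdd 1), by simp [F, pwHom_one]⟩
  have hc : Nat.card (Multiplicative (ZMod (2 ^ k)) ⋊[φ] Multiplicative (ZMod 2)) = Nat.card S := by
    rw [Nat.card_congr SemidirectProduct.equivProd, Nat.card_prod, hcard]
    simp [mul_comm]
  have : Finite (Multiplicative (ZMod (2 ^ k)) ⋊[φ] Multiplicative (ZMod 2)) :=
    Nat.finite_of_card_ne_zero (by rw [hc]; exact Nat.card_pos.ne')
  have hbij : Function.Bijective F := (Nat.bijective_iff_surjective_and_card F).2 ⟨hsurj, hc⟩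
  exact ⟨(MulEquiv.ofBijective F hbij).symm⟩

theorem Q_iso {S : Type*} [Group S] [Finite S] (a b : S)
    (ha : a ^ 4 = 1) (hb : b ^ 2 = a ^ 2) (hab : a * b = b * a⁻¹)
    (hgen : ∀ K : Subgroup S, a ∈ K → b ∈ K → K = ⊤) (hcard : Nat.card S = 8) :
    Nonempty (S ≃* QuaternionGroup 2) := by
  let A := pwHom 4 a ha
  have hA : ∀ i : ZMod 4, A (Multiplicative.ofAdd i) = a ^ (i.val) := by
    intro i
    have := pwHom_apply 4 a ha (i.val : ℤ)
    rw [zpow_natCast, Int.cast_natCast, ZMod.natCast_zmod_val] at this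
    exact this
  have hm : ∀ i j : ZMod 4, A (Multiplicative.ofAdd (i + j)) =
      A (Multiplicative.ofAdd i) * A (Multiplicative.ofAdd j) := by
    intro i j; rw [ofAdd_add, map_mul]
  have hs : ∀ i j : ZMod 4, A (Multiplicative.ofAdd (i - j)) =
      A (Multiplicative.ofAdd i) * (A (Multiplicative.ofAdd j))⁻¹ := by
    intro i j; rw [ofAdd_sub, map_div, div_eq_mul_inv]
  have hc : ∀ i : ZMod 4, A (Multiplicative.ofAdd i) * b = b * (A (Multiplicative.ofAdd i))⁻¹ := by
    intro i
    rw [hA, ← inv_pow]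
    have : SemiconjBy b a⁻¹ a := hab.symm
    exact (this.pow_right _).symm
  have hcm : ∀ i j : ZMod 4, A (Multiplicative.ofAdd j) * (A (Multiplicative.ofAdd i))⁻¹ =
      (A (Multiplicative.ofAdd i))⁻¹ * A (Multiplicative.ofAdd j) := by
    intro i j
    have : Commute (A (Multiplicative.ofAdd j)) (A (Multiplicative.ofAdd i)) := by
      change _ * _ = _ * _
      rw [← hm, add_comm, hm]
    exact this.inv_right
  have h2 : A (Multiplicative.ofAdd (2 : ZMod 4)) = b * b := by
    rw [hA, ← pow_two, hb]; rfl
  have h1 : A (Multiplicative.ofAdd (1 : ZMod 4)) = a := by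
    rw [hA]; exact pow_one a
  have h0 : A (Multiplicative.ofAdd (0 : ZMod 4)) = 1 := by
    rw [hA]; exact pow_zero a
  let f : QuaternionGroup 2 → S := fun x => match x with
    | QuaternionGroup.a i => A (Multiplicative.ofAdd (i : ZMod 4))
    | QuaternionGroup.xa i => b * A (Multiplicative.ofAdd (i : ZMod 4))
  let F : QuaternionGroup 2 →* S := MonoidHom.mk' f (by
    rintro (i | i) (j | j)
    · rw [QuaternionGroup.a_mul_a]
      exact hm i j
    · rw [QuaternionGroup.a_mul_xa]
      change b * A _ = A _ * (b * A _)
      have e1 := hs j i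
      have e2 := hc i
      have e3 := hcm i j
      calc _ = b * (A (Multiplicative.ofAdd (j : ZMod 4)) *
              (A (Multiplicative.ofAdd (i : ZMod 4)))⁻¹) := congrArg _ e1
        _ = _ := by rw [e3, ← mul_assoc, ← mul_assoc, e2]
    · rw [QuaternionGroup.xa_mul_a]
      change b * A _ = b * A _ * (A _)
      rw [hm, mul_assoc]
    · rw [QuaternionGroup.xa_mul_xa]
      change A _ = b * A _ * (b * A _)
      have e1 := hs (2 + j) i
      have e2 := hc i
      have e3 := hcm i j
      have e4 := hm 2 j
      calc _ = A (Multiplicative.ofAdd (2 + j : ZMod 4)) *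
              (A (Multiplicative.ofAdd (i : ZMod 4)))⁻¹ := e1
        _ = b * b * ((A (Multiplicative.ofAdd (i : ZMod 4)))⁻¹ *
              A (Multiplicative.ofAdd (j : ZMod 4))) := by
            rw [e4, h2, mul_assoc, e3]
        _ = b * (A (Multiplicative.ofAdd (i : ZMod 4)) * b) *
              A (Multiplicative.ofAdd (j : ZMod 4)) := by rw [e2]; simp only [mul_assoc]
        _ = _ := by simp only [mul_assoc])
  have hsurj : Function.Surjective F := by
    rw [← MonoidHom.range_eq_top]
    apply hgen
    · exact ⟨QuaternionGroup.a 1, h1⟩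
    · exact ⟨QuaternionGroup.xa 0, by change b * A _ = b; rw [h0, mul_one]⟩
  have hc : Nat.card (QuaternionGroup 2) = Nat.card S := by
    rw [Nat.card_eq_fintype_card, QuaternionGroup.card, hcard]
  have hbij : Function.Bijective F := (Nat.bijective_iff_surjective_and_card F).2 ⟨hsurj, hc⟩
  exact ⟨(MulEquiv.ofBijective F hbij).symm⟩


theorem invol_eq {S : Type*} [Group S] (x d : S) (m : ℕ) (hx : orderOf x = 2 ^ m)
    (hd : d ∈ Subgroup.zpowers x) (hd2 : d ^ 2 = 1) (hd1 : d ≠ 1) :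
    1 ≤ m ∧ d = x ^ (2 ^ (m - 1)) := by
  obtain ⟨j, rfl⟩ := hd
  simp only at hd2 hd1 ⊢
  rw [← zpow_natCast, ← zpow_mul] at hd2
  have h1 := orderOf_dvd_iff_zpow_eq_one.2 hd2
  have h2 : ¬ ((orderOf x : ℤ) ∣ j) := fun h => hd1 (orderOf_dvd_iff_zpow_eq_one.1 h)
  rw [hx] at h1 h2
  rcases m with _ | m
  · simp at h2
  refine ⟨by omega, ?_⟩
  push_cast at h1 h2
  rw [pow_succ] at h1 h2
  obtain ⟨t, rfl⟩ : (2 : ℤ) ^ m ∣ j := Int.dvd_of_mul_dvd_mul_right (by norm_num) h1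
  rcases Int.even_or_odd' t with ⟨u, rfl | rfl⟩
  · exact absurd ⟨u, by ring⟩ h2
  · have h3 : x ^ (2 ^ (m + 1)) = 1 := by rw [← hx]; exact pow_orderOf_eq_one x
    have e : (2 : ℤ) ^ m * (2 * u + 1) = ((2 ^ (m + 1) : ℕ) : ℤ) * u + ((2 ^ m : ℕ) : ℤ) := by
      push_cast; ring
    rw [e, zpow_add, zpow_mul, zpow_natCast, zpow_natCast, h3, one_zpow, one_mul]
    simp

theorem minnonab {S : Type*} [Group S] [Finite S] (h2 : IsPGroup 2 S)
    (hna : ∃ a b : S, a * b ≠ b * a)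
    (hmin : ∀ K : Subgroup S, (∃ a ∈ K, ∃ b ∈ K, a * b ≠ b * a) → K = ⊤)
    (hcyc : IsCyclic (Subgroup.center S)) :
    Nonempty (S ≃* QuaternionGroup 2) ∨ ∃ k, 2 ≤ k ∧
      ∃ φ : Multiplicative (ZMod 2) →* MulAut (Multiplicative (ZMod (2 ^ k))),
        (∀ g : Multiplicative (ZMod (2 ^ k)),
          φ (Multiplicative.ofAdd 1) g = g ^ (1 + 2 ^ (k - 1))) ∧
        Nonempty (S ≃* (Multiplicative (ZMod (2 ^ k)) ⋊[φ] Multiplicative (ZMod 2))) := by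
  have : Fact (Nat.Prime 2) := ⟨Nat.prime_two⟩
  obtain ⟨n, hn⟩ := h2.exists_card_eq
  have hgen : ∀ a b : S, a * b ≠ b * a → ∀ K : Subgroup S, a ∈ K → b ∈ K → K = ⊤ :=
    fun a b hab K ha hb => hmin K ⟨a, ha, b, hb, hab⟩
  have hMcomm : ∀ M : Subgroup S, M ≠ ⊤ → ∀ x ∈ M, ∀ y ∈ M, x * y = y * x := by
    intro M hM x hx y hy
    by_contra hne
    exact hM (hmin M ⟨x, hx, y, hy, hne⟩)
  have hM : ∀ x : S, ∃ M : Subgroup S, M.index = 2 ∧ x ∈ M := by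
    intro x
    have hz : Subgroup.zpowers x ≠ ⊤ := by
      intro htop
      obtain ⟨a, b, hab⟩ := hna
      apply hab
      have ha : a ∈ Subgroup.zpowers x := htop ▸ Subgroup.mem_top a
      have hb : b ∈ Subgroup.zpowers x := htop ▸ Subgroup.mem_top b
      obtain ⟨i, rfl⟩ := ha
      obtain ⟨j, rfl⟩ := hb
      exact (Commute.refl x).zpow_zpow i j
    obtain ⟨r, hr⟩ := (h2.to_subgroup (Subgroup.zpowers x)).exists_card_eq
    have hlt : r < n := by
      by_contra! hge
      apply hz
      apply Subgroup.eq_top_of_le_card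
      rw [hn, hr]
      exact Nat.pow_le_pow_right (by norm_num) hge
    obtain ⟨M, hMc, hle⟩ := Sylow.exists_subgroup_card_pow_prime_le 2 (m := n - 1)
      (by rw [hn]; exact pow_dvd_pow _ (by omega)) (Subgroup.zpowers x) hr (by omega)
    refine ⟨M, ?_, hle (Subgroup.mem_zpowers x)⟩
    have := M.card_mul_index
    rw [hMc, hn] at this
    have e : n = (n - 1) + 1 := by omega
    rw [e, pow_succ] at this
    simp only [Nat.add_sub_cancel] at this
    exact Nat.eq_of_mul_eq_mul_left (by positivity) this
  have hinf : ∀ a b : S, a * b ≠ b * a → ∃ M₁ M₂ : Subgroup S, M₁.index = 2 ∧ M₂.index = 2 ∧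
      M₁ ⊓ M₂ ≤ Subgroup.center S := by
    intro a b hab
    obtain ⟨M₁, h1, ha⟩ := hM a
    obtain ⟨M₂, h2, hb⟩ := hM b
    refine ⟨M₁, M₂, h1, h2, ?_⟩
    intro x hx
    have ht1 : M₁ ≠ ⊤ := by rintro rfl; simp at h1
    have ht2 : M₂ ≠ ⊤ := by rintro rfl; simp at h2
    have hK := hgen a b hab (Subgroup.centralizer {x})
      (Subgroup.mem_centralizer_singleton_iff.2 (hMcomm M₁ ht1 _ ha _ hx.1))
      (Subgroup.mem_centralizer_singleton_iff.2 (hMcomm M₂ ht2 _ hb _ hx.2))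
    rw [Subgroup.mem_center_iff]
    intro g
    exact Subgroup.mem_centralizer_singleton_iff.1 (hK ▸ Subgroup.mem_top g)
  have hsq : ∀ s : S, s ^ 2 ∈ Subgroup.center S := by
    intro s
    obtain ⟨a, b, hab⟩ := hna
    obtain ⟨M₁, M₂, h1, h2, h3⟩ := hinf a b hab
    exact h3 ⟨Subgroup.sq_mem_of_index_two h1 s, Subgroup.sq_mem_of_index_two h2 s⟩
  have hidx : (Subgroup.center S).index = 4 := by
    obtain ⟨a, b, hab⟩ := hna
    obtain ⟨M₁, M₂, h1, h2, h3⟩ := hinf a b hab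
    have hle : (Subgroup.center S).index ≤ 4 := by
      have e1 := Subgroup.index_antitone h3
      have e2 := Subgroup.index_inf_le (H := M₁) (K := M₂)
      rw [h1, h2] at e2
      omega
    have hnc : ¬ IsCyclic (S ⧸ Subgroup.center S) := by
      intro hc
      apply hab
      exact commutative_of_cyclic_center_quotient (QuotientGroup.mk' (Subgroup.center S))
        (by simp) a b
    have h0 : (Subgroup.center S).index ≠ 0 := Subgroup.index_ne_zero_of_finite
    have hne1 : (Subgroup.center S).index ≠ 1 := by
      intro h
      rw [Subgroup.index_eq_one] at h
      exact hab ((Subgroup.mem_center_iff.1 (h ▸ Subgroup.mem_top b : b ∈ Subgroup.center S)) a)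
    have hp : ¬ (Subgroup.center S).index.Prime := by
      intro h
      have : Fact (Subgroup.center S).index.Prime := ⟨h⟩
      exact hnc (isCyclic_of_prime_card (p := (Subgroup.center S).index) rfl)
    interval_cases hh : (Subgroup.center S).index <;> first | rfl | exact absurd rfl h0 | exact absurd rfl hne1 | exact absurd (by norm_num) hp
  -- commutators
  have hcen : ∀ a b : S, a * b * a⁻¹ * b⁻¹ ∈ Subgroup.center S := by
    intro a b
    have e : a * b * a⁻¹ * b⁻¹ = (a * b) ^ 2 * (b⁻¹ * a⁻¹ * b) ^ 2 * (b⁻¹) ^ 2 := by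
      simp only [pow_two]; group
    rw [e]
    exact mul_mem (mul_mem (hsq _) (hsq _)) (hsq _)
  have hcz : ∀ z ∈ Subgroup.center S, ∀ x, x * z = z * x :=
    fun z hz x => Subgroup.mem_center_iff.1 hz x
  obtain ⟨ζ', hζ'⟩ := hcyc.exists_generator
  set ζ : S := (ζ' : S) with hζdef
  have hζ : ∀ x ∈ Subgroup.center S, ∃ i : ℤ, ζ ^ i = x := by
    intro x hx
    obtain ⟨i, hi⟩ := hζ' ⟨x, hx⟩
    refine ⟨i, ?_⟩
    have := congrArg Subtype.val hi
    simpa using this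
  obtain ⟨m, hm⟩ := (h2.to_subgroup (Subgroup.center S)).exists_card_eq
  have hζo : orderOf ζ = 2 ^ m := by
    rw [← hm, hζdef, Subgroup.orderOf_coe]
    exact orderOf_eq_card_of_forall_mem_zpowers hζ'
  have hζc : ζ ∈ Subgroup.center S := ζ'.2
  have hζp : ζ ^ (2 ^ m) = 1 := by rw [← hζo]; exact pow_orderOf_eq_one ζ
  have hScard : Nat.card S = 4 * 2 ^ m := by
    rw [← (Subgroup.center S).card_mul_index, hm, hidx, mul_comm]
  set Q : Subgroup S := Subgroup.zpowers (ζ ^ 2) with hQ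
  have hQeven : ∀ i : ℤ, ζ ^ (2 * i) ∈ Q := by
    intro i
    rw [zpow_mul, zpow_ofNat]
    exact Subgroup.zpow_mem_zpowers (ζ ^ 2) i
  have hQodd : ∀ x ∈ Subgroup.center S, x ∉ Q → ∃ u : ℤ, x = ζ ^ (2 * u + 1) := by
    intro x hx hxQ
    obtain ⟨i, rfl⟩ := hζ x hx
    rcases Int.even_or_odd' i with ⟨u, rfl | rfl⟩
    · exact absurd (hQeven u) hxQ
    · exact ⟨u, rfl⟩
  have hF4 : ∀ x ∈ Subgroup.center S, x ∉ Q → ∀ y ∈ Subgroup.center S, y ∈ Subgroup.zpowers x := by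
    intro x hx hxQ y hy
    obtain ⟨u, rfl⟩ := hQodd x hx hxQ
    have hco : IsCoprime (2 * u + 1) ((2 : ℤ) ^ m) := by
      apply IsCoprime.pow_right
      exact ⟨1, -u, by ring⟩
    obtain ⟨s, t, hst⟩ := hco
    have h1 : ζ ∈ Subgroup.zpowers (ζ ^ (2 * u + 1)) := by
      refine ⟨s, ?_⟩
      simp only
      rw [← zpow_mul]
      have e : (2 * u + 1) * s = 1 + ((2 ^ m : ℕ) : ℤ) * (-t) := by push_cast; linear_combination hst
      rw [e, zpow_add, zpow_mul, zpow_natCast, hζp]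
      simp
    obtain ⟨i, rfl⟩ := hζ y hy
    exact zpow_mem h1 i
  have hF5 : ∀ x ∈ Subgroup.center S, x ∉ Q → ∀ y ∈ Subgroup.center S, y ∉ Q → x * y ∈ Q := by
    intro x hx hxQ y hy hyQ
    obtain ⟨u, rfl⟩ := hQodd x hx hxQ
    obtain ⟨v, rfl⟩ := hQodd y hy hyQ
    rw [← zpow_add]
    have e : 2 * u + 1 + (2 * v + 1) = 2 * (u + v + 1) := by ring
    rw [e]
    exact hQeven _
  have hQc : Q ≤ Subgroup.center S := by
    rw [hQ, Subgroup.zpowers_le]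
    exact pow_mem hζc 2
  have hc1 : ∀ a b : S, a * b ≠ b * a → a * b * a⁻¹ * b⁻¹ ≠ 1 := by
    intro a b hab h
    apply hab
    rw [mul_inv_eq_one, mul_inv_eq_iff_eq_mul] at h
    exact h
  have hcsq : ∀ a b : S, (a * b * a⁻¹ * b⁻¹) ^ 2 = 1 := by
    intro a b
    have h1 := hcz _ (hcen a b)
    have h3 := hcz _ (hsq a) b
    set c := a * b * a⁻¹ * b⁻¹ with hc
    have e1 : a * b = c * b * a := by rw [hc]; group
    have e2 : a ^ 2 * b = c ^ 2 * b * a ^ 2 := by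
      calc a ^ 2 * b = a * (a * b) := by rw [pow_two, mul_assoc]
        _ = (a * c) * b * a := by rw [e1]; simp only [mul_assoc]
        _ = c * (a * b) * a := by rw [h1 a]; simp only [mul_assoc]
        _ = c ^ 2 * b * a ^ 2 := by rw [e1]; simp only [pow_two, mul_assoc]
    rw [← h3] at e2
    have e3 : 1 * (b * a ^ 2) = c ^ 2 * (b * a ^ 2) := by rw [one_mul, ← mul_assoc]; exact e2
    exact (mul_right_cancel e3).symm
  have hmul : ∀ a b : S, (a * b) ^ 2 = (a * b * a⁻¹ * b⁻¹) * a ^ 2 * b ^ 2 := by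
    intro a b
    have h3 := hcz _ (hsq a) b
    calc (a * b) ^ 2 = (a * b * a⁻¹ * b⁻¹) * (b * a ^ 2) * b := by simp only [pow_two]; group
      _ = _ := by rw [h3]; simp only [pow_two, mul_assoc]
  -- the key non-membership
  have hF6 : ∀ a b : S, a * b ≠ b * a → ¬ (a ^ 2 ∈ Q ∧ b ^ 2 ∈ Q ∧ a * b * a⁻¹ * b⁻¹ ∈ Q) := by
    rintro a b hab ⟨ha, hb, hc⟩
    have h1 := hcz _ (hcen a b)
    have hc1' := hc1 a b hab
    have hcsq' := hcsq a b
    have hcc := hcen a b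
    set c := a * b * a⁻¹ * b⁻¹ with hcdef
    have e1 : b * a * b⁻¹ = a * c⁻¹ := by
      have e0 : b * a * b⁻¹ = c⁻¹ * a := by rw [hcdef]; group
      rw [e0]
      exact (Commute.inv_right (h1 a)).symm
    have hstep : ∀ k : ℤ, b * a ^ k = a ^ k * b * (c⁻¹) ^ k := by
      intro k
      have h4 : b * a ^ k * b⁻¹ = a ^ k * (c⁻¹) ^ k := by
        rw [← conj_zpow, e1]
        exact (Commute.inv_right (h1 a)).mul_zpow k
      have h5 : b * a ^ k = a ^ k * (c⁻¹) ^ k * b := by rw [← h4]; group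
      rw [h5, mul_assoc, mul_assoc]
      congr 1
      exact (((Commute.inv_right (h1 b)).zpow_right k)).symm
    have hstep' : ∀ k : ℤ, b⁻¹ * a ^ k = a ^ k * b⁻¹ * c ^ k := by
      intro k
      have h5 : b * (a ^ k * b⁻¹ * c ^ k) = a ^ k := by
        calc b * (a ^ k * b⁻¹ * c ^ k) = (b * a ^ k) * b⁻¹ * c ^ k := by simp only [mul_assoc]
          _ = a ^ k * (b * ((c⁻¹) ^ k * b⁻¹)) * c ^ k := by rw [hstep]; simp only [mul_assoc]
          _ = a ^ k * (b * (b⁻¹ * (c⁻¹) ^ k)) * c ^ k := by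
            rw [((Commute.inv_right (h1 b⁻¹)).zpow_right k).eq]
          _ = a ^ k := by simp
      calc b⁻¹ * a ^ k = b⁻¹ * (b * (a ^ k * b⁻¹ * c ^ k)) := by rw [h5]
        _ = _ := by rw [inv_mul_cancel_left]
    have hall : ∀ s : S, ∃ i j : ℤ, ∃ q ∈ Q, s = a ^ i * b ^ j * q := by
      intro s
      have hs : s ∈ Subgroup.closure ({a, b} : Set S) := by
        rw [hgen a b hab (Subgroup.closure {a, b}) (Subgroup.subset_closure (by simp))
          (Subgroup.subset_closure (by simp))]
        trivial
      induction hs using Subgroup.closure_induction_left with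
      | one => exact ⟨0, 0, 1, one_mem _, by simp⟩
      | mul_left x hx y hy ih =>
        obtain ⟨i, j, q, hq, rfl⟩ := ih
        rcases hx with rfl | rfl
        · exact ⟨1 + i, j, q, hq, by rw [zpow_add, zpow_one]; simp only [mul_assoc]⟩
        · refine ⟨i, 1 + j, (c⁻¹) ^ i * q, mul_mem (zpow_mem (inv_mem hc) _) hq, ?_⟩
          have h4 : Commute (x ^ j) ((c⁻¹) ^ i) := (Commute.inv_right (h1 (x ^ j))).zpow_right i
          calc x * (a ^ i * x ^ j * q) = (x * a ^ i) * x ^ j * q := by simp only [mul_assoc]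
            _ = a ^ i * x * ((c⁻¹) ^ i * x ^ j) * q := by rw [hstep]; simp only [mul_assoc]
            _ = _ := by rw [← h4.eq, zpow_add, zpow_one]; simp only [mul_assoc]
      | inv_mul_cancel x hx y hy ih =>
        obtain ⟨i, j, q, hq, rfl⟩ := ih
        rcases hx with rfl | rfl
        · exact ⟨-1 + i, j, q, hq, by rw [zpow_add, zpow_neg_one]; simp only [mul_assoc]⟩
        · refine ⟨i, -1 + j, c ^ i * q, mul_mem (zpow_mem hc _) hq, ?_⟩
          have h4 : Commute (x ^ j) (c ^ i) := Commute.zpow_right (h1 (x ^ j)) i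
          calc x⁻¹ * (a ^ i * x ^ j * q) = (x⁻¹ * a ^ i) * x ^ j * q := by simp only [mul_assoc]
            _ = a ^ i * x⁻¹ * (c ^ i * x ^ j) * q := by rw [hstep']; simp only [mul_assoc]
            _ = _ := by rw [← h4.eq, zpow_add, zpow_neg_one]; simp only [mul_assoc]
    -- noncentrality
    have hna' : a ∉ Subgroup.center S := fun h => hab (hcz a h b).symm
    have hnb' : b ∉ Subgroup.center S := fun h => hab (hcz b h a)
    have hnab : a * b ∉ Subgroup.center S := by
      intro h
      apply hab
      have := hcz _ h a
      rw [mul_assoc] at this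
      exact mul_left_cancel this
    obtain ⟨i, j, q, hq, hs⟩ := hall ζ
    have hij : a ^ i * b ^ j ∈ Subgroup.center S := by
      have : a ^ i * b ^ j = ζ * q⁻¹ := by rw [hs]; group
      rw [this]
      exact mul_mem hζc (inv_mem (hQc hq))
    have hζQ : ζ ∈ Q := by
      have ea : ∀ u : ℤ, a ^ (2 * u) ∈ Q := fun u => by rw [zpow_mul, zpow_ofNat]; exact zpow_mem ha u
      have eb : ∀ u : ℤ, b ^ (2 * u) ∈ Q := fun u => by rw [zpow_mul, zpow_ofNat]; exact zpow_mem hb u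
      rcases Int.even_or_odd' i with ⟨u, rfl | rfl⟩ <;> rcases Int.even_or_odd' j with ⟨v, rfl | rfl⟩
      · rw [hs]; exact mul_mem (mul_mem (ea u) (eb v)) hq
      · exfalso
        apply hnb'
        rw [zpow_add, zpow_one] at hij
        exact (Subgroup.mul_mem_cancel_left _ (hQc (eb v))).1
          ((Subgroup.mul_mem_cancel_left _ (hQc (ea u))).1 hij)
      · exfalso
        apply hna'
        rw [zpow_add, zpow_one] at hij
        exact (Subgroup.mul_mem_cancel_left _ (hQc (ea u))).1
          ((Subgroup.mul_mem_cancel_right _ (hQc (eb v))).1 hij)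
      · exfalso
        apply hnab
        have e : a ^ (2 * u + 1) * b ^ (2 * v + 1) = a ^ (2 * u) * (a * b) * b ^ (2 * v) := by
          rw [zpow_add, add_comm (2 * v), zpow_add, zpow_one, zpow_one]; simp only [mul_assoc]
        rw [e] at hij
        exact (Subgroup.mul_mem_cancel_left _ (hQc (ea u))).1
          ((Subgroup.mul_mem_cancel_right _ (hQc (eb v))).1 hij)
    obtain ⟨t, ht⟩ := hζQ
    simp only at ht
    have h5 : ζ ^ (2 * t - 1) = 1 := by
      rw [zpow_sub, zpow_one, zpow_mul, zpow_ofNat, mul_inv_eq_one]; exact ht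
    have h6 := orderOf_dvd_iff_zpow_eq_one.2 h5
    rw [hζo] at h6
    rcases m with _ | m
    · apply hc1'
      obtain ⟨r, hr⟩ := hζ c hcc
      rw [← hr]
      have : ζ = 1 := by simpa using hζp
      rw [this, one_zpow]
    · push_cast at h6
      rw [pow_succ] at h6
      obtain ⟨r, hr⟩ := h6
      have : (2 : ℤ) * t - 1 = 2 * (2 ^ m * r) := by rw [hr]; ring
      omega
  by_cases hI : ∃ b : S, b ∉ Subgroup.center S ∧ b ^ 2 = 1
  · right
    obtain ⟨b, hbc, hb⟩ := hI
    obtain ⟨a, hab⟩ : ∃ a, a * b ≠ b * a := by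
      by_contra! hcon
      exact hbc (Subgroup.mem_center_iff.2 hcon)
    obtain ⟨a, hab, haQ⟩ : ∃ a, a * b ≠ b * a ∧ a ^ 2 ∉ Q := by
      by_cases haQ : a ^ 2 ∈ Q
      · refine ⟨a * b, ?_, ?_⟩
        · intro h
          apply hab
          rw [← mul_assoc b] at h
          exact mul_right_cancel h
        · rw [hmul, hb, mul_one]
          intro h
          exact hF6 a b hab ⟨haQ, hb ▸ one_mem _, (Subgroup.mul_mem_cancel_right _ haQ).1 h⟩
      · exact ⟨a, hab, haQ⟩
    have hord : orderOf (a ^ 2) = 2 ^ m := by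
      have hzz : Subgroup.zpowers (a ^ 2) = Subgroup.center S := by
        apply le_antisymm
        · rw [Subgroup.zpowers_le]; exact hsq a
        · exact fun y hy => hF4 _ (hsq a) haQ y hy
      rw [← hm, ← Nat.card_zpowers, hzz]
    have hcc := hcen a b
    have hd := invol_eq (a ^ 2) (a * b * a⁻¹ * b⁻¹)⁻¹ m hord
      (hF4 _ (hsq a) haQ _ (inv_mem hcc)) (by rw [inv_pow, hcsq, inv_one])
      (by rw [Ne, inv_eq_one]; exact hc1 a b hab)
    refine ⟨m + 1, by omega, M_iso a b (m + 1) (by omega) ?_ hb ?_ (hgen a b hab) ?_⟩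
    · rw [pow_succ', pow_mul, ← hord, pow_orderOf_eq_one]
    · have e : b * a * b⁻¹ = a * (a * b * a⁻¹ * b⁻¹)⁻¹ := by
        rw [hcz _ (inv_mem hcc) a]; group
      rw [e, hd.2, ← pow_mul, ← pow_succ' 2, Nat.sub_add_cancel hd.1, Nat.add_sub_cancel, pow_add,
        pow_one]
    · rw [hScard]; ring
  · left
    push Not at hI
    have hnQ : ∀ x, x ∉ Subgroup.center S → x ^ 2 ∉ Q := by
      intro x hx hxQ
      obtain ⟨t, ht⟩ := hxQ
      simp only at ht
      have hzt : ζ ^ (-t) ∈ Subgroup.center S := zpow_mem hζc _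
      apply hI (x * ζ ^ (-t))
      · intro h
        exact hx ((Subgroup.mul_mem_cancel_right _ hzt).1 h)
      · have hcm : Commute x (ζ ^ (-t)) := hcz _ hzt x
        rw [hcm.mul_pow, ← ht]
        rw [← zpow_natCast, ← zpow_natCast, ← zpow_mul, ← zpow_mul, ← zpow_add]
        convert zpow_zero ζ using 2
        push_cast; ring
    obtain ⟨a, b, hab⟩ := hna
    have hna' : a ∉ Subgroup.center S := fun h => hab (hcz a h b).symm
    have hnb' : b ∉ Subgroup.center S := fun h => hab (hcz b h a)
    have hnab : a * b ∉ Subgroup.center S := by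
      intro h
      apply hab
      have := hcz _ h a
      rw [mul_assoc] at this
      exact mul_left_cancel this
    have h3 := hnQ _ hnab
    rw [hmul, mul_assoc] at h3
    have h4 := hF5 _ (hsq a) (hnQ a hna') _ (hsq b) (hnQ b hnb')
    have hcQ : a * b * a⁻¹ * b⁻¹ ∉ Q := fun h => h3 (mul_mem h h4)
    have hcsq' := hcsq a b
    have hcne := hc1 a b hab
    have hcc := hcen a b
    have hcz' := hcz _ hcc
    have e1 : a * b = (a * b * a⁻¹ * b⁻¹) * b * a := by group
    set c := a * b * a⁻¹ * b⁻¹ with hcdef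
    have hel : ∀ y ∈ Subgroup.center S, y ≠ 1 → y = c := by
      intro y hy hy1
      obtain ⟨i, rfl⟩ := hF4 c hcc hcQ y hy
      simp only at hy1 ⊢
      rcases Int.even_or_odd' i with ⟨u, rfl | rfl⟩
      · exfalso; apply hy1; rw [zpow_mul]
        have : c ^ (2 : ℤ) = 1 := by exact_mod_cast hcsq'
        rw [this, one_zpow]
      · rw [zpow_add, zpow_mul]
        have : c ^ (2 : ℤ) = 1 := by exact_mod_cast hcsq'
        rw [this, one_zpow, one_mul, zpow_one]
    have ha2 : a ^ 2 = c := hel _ (hsq a) (fun h => hnQ a hna' (h ▸ one_mem _))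
    have hb2 : b ^ 2 = c := hel _ (hsq b) (fun h => hnQ b hnb' (h ▸ one_mem _))
    have hoc : orderOf c = 2 := orderOf_eq_prime hcsq' hcne
    have hcard : Nat.card (Subgroup.center S) = 2 := by
      have hzz : Subgroup.zpowers c = Subgroup.center S := by
        apply le_antisymm
        · rw [Subgroup.zpowers_le]; exact hcc
        · exact fun y hy => hF4 _ hcc hcQ y hy
      rw [← hoc, ← Nat.card_zpowers, hzz]
    refine Q_iso a b ?_ (by rw [ha2, hb2]) ?_ (hgen a b hab) ?_
    · have : a ^ 4 = (a ^ 2) ^ 2 := by rw [← pow_mul]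
      rw [this, ha2, hcsq']
    · have h7 : c * a = a⁻¹ := by
        rw [eq_inv_iff_mul_eq_one, mul_assoc, ← pow_two, ha2, ← pow_two, hcsq']
      rw [e1, mul_assoc, ← hcz', mul_assoc, hcz', h7]
    · rw [← (Subgroup.center S).card_mul_index, hcard, hidx]


theorem rdim_ge3 {G : Type*} [Group G] (h : rdim G = 3) :
    (∃ ρ : G →* GL (Fin 3) ℂ, Function.Injective ρ) ∧
      ¬ ∃ ρ : G →* GL (Fin 2) ℂ, Function.Injective ρ := by
  have hne : {n : ℕ | ∃ ρ : G →* GL (Fin n) ℂ, Function.Injective ρ}.Nonempty := by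
    by_contra hcon
    rw [Set.not_nonempty_iff_eq_empty] at hcon
    unfold rdim at h
    rw [hcon] at h
    simp at h
  have hmem := Nat.sInf_mem hne
  refine ⟨?_, ?_⟩
  · have h' : sInf {n : ℕ | ∃ ρ : G →* GL (Fin n) ℂ, Function.Injective ρ} = 3 := h
    rw [h'] at hmem
    exact hmem
  · intro h2
    have := Nat.sInf_le (s := {n : ℕ | ∃ ρ : G →* GL (Fin n) ℂ, Function.Injective ρ}) h2
    unfold rdim at h
    omega

theorem rdim_lt3 {H : Type*} [Group H] (ρ : H →* GL (Fin 3) ℂ) (hρ : Function.Injective ρ)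
    (h : rdim H < 3) : ∃ σ : H →* GL (Fin 2) ℂ, Function.Injective σ := by
  have hne : {n : ℕ | ∃ ρ : H →* GL (Fin n) ℂ, Function.Injective ρ}.Nonempty := ⟨3, ρ, hρ⟩
  have hmem := Nat.sInf_mem hne
  change rdim H ∈ {n : ℕ | ∃ ρ : H →* GL (Fin n) ℂ, Function.Injective ρ} at hmem
  generalize rdim H = n at h hmem
  obtain ⟨τ, hτ⟩ := hmem
  interval_cases n
  · have : Subsingleton H := hτ.subsingleton
    exact ⟨1, fun a b _ => Subsingleton.elim a b⟩
  · refine ⟨(Units.map (Matrix.scalar (Fin 2) : ℂ →+* _).toMonoidHom).comp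
      (Matrix.GeneralLinearGroup.det.comp τ), ?_⟩
    intro a b hab
    apply hτ
    have h1 := congrArg (fun M : GL (Fin 2) ℂ => (M : Matrix (Fin 2) (Fin 2) ℂ) 0 0) hab
    simp at h1
    ext i j
    fin_cases i; fin_cases j
    simpa using h1
  · exact ⟨τ, hτ⟩

theorem split_rep {G : Type*} [Group G] (σ : G →* Module.End ℂ (Fin 3 → ℂ))
    (hσ : Function.Injective σ) (z : G) (hz : ∀ g, g * z = z * g) (hz2 : z ^ 2 = 1) (hz1 : z ≠ 1)
    (hdet : LinearMap.det (σ z) = 1) :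
    ∃ (α : G →* GL (Fin 2) ℂ) (β : G →* ℂˣ),
      (∀ g, α g = 1 → β g = 1 → g = 1) ∧ ((α z : GL (Fin 2) ℂ) : Matrix (Fin 2) (Fin 2) ℂ) = -1 := by
  set T := σ z with hT
  have hTT : ∀ v, T (T v) = v := by
    intro v
    rw [← Module.End.mul_apply, hT, ← map_mul, ← pow_two, hz2, map_one]; rfl
  have hcomm : ∀ g v, σ g (T v) = T (σ g v) := by
    intro g v
    rw [hT, ← Module.End.mul_apply, ← Module.End.mul_apply, ← map_mul, ← map_mul, hz]
  set U : Submodule ℂ (Fin 3 → ℂ) := LinearMap.ker (T + 1) with hU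
  set L : Submodule ℂ (Fin 3 → ℂ) := LinearMap.ker (T - 1) with hL
  have memU : ∀ v, v ∈ U ↔ T v = -v := by
    intro v
    rw [hU, LinearMap.mem_ker, LinearMap.add_apply, Module.End.one_apply, add_eq_zero_iff_eq_neg]
  have memL : ∀ v, v ∈ L ↔ T v = v := by
    intro v
    rw [hL, LinearMap.mem_ker, LinearMap.sub_apply, Module.End.one_apply, sub_eq_zero]
  have hdec : ∀ v, ∃ u ∈ U, ∃ l ∈ L, v = u + l := by
    intro v
    refine ⟨(1 / 2 : ℂ) • (v - T v), ?_, (1 / 2 : ℂ) • (v + T v), ?_, ?_⟩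
    · rw [memU, map_smul, map_sub, hTT, ← smul_neg, neg_sub]
    · rw [memL, map_smul, map_add, hTT, add_comm]
    · rw [← smul_add]
      ext i
      simp
      ring
  have hcompl : IsCompl U L := by
    refine ⟨?_, ?_⟩
    · rw [Submodule.disjoint_def]
      intro x hx hx'
      rw [memU] at hx
      rw [memL] at hx'
      rw [hx'] at hx
      exact self_eq_neg.1 hx
    · rw [codisjoint_iff, eq_top_iff]
      intro v _
      obtain ⟨u, hu, l, hl, rfl⟩ := hdec v
      exact Submodule.add_mem_sup hu hl
  have hsum := Submodule.finrank_add_eq_of_isCompl hcompl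
  rw [Module.finrank_fin_fun] at hsum
  have hUle : U ≤ U.comap T := by
    intro v hv
    rw [Submodule.mem_comap, memU, hTT]
    rw [memU] at hv
    rw [hv, neg_neg]
  have hd := LinearMap.det_eq_det_mul_det (W := U) T hUle
  have e1 : T.restrict (p := U) (q := U) hUle = (-1 : ℂ) • LinearMap.id := by
    ext v : 2
    have := (memU v).1 v.2
    simp [this]
  have e2 : U.mapQ U T hUle = LinearMap.id := by
    refine LinearMap.ext fun w => ?_
    obtain ⟨v, rfl⟩ := Submodule.Quotient.mk_surjective _ w
    rw [Submodule.mapQ_apply, LinearMap.id_apply, Submodule.Quotient.eq, memU, map_sub, hTT, neg_sub]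
  rw [e1, e2, LinearMap.det_smul, LinearMap.det_id, LinearMap.det_id, hdet, mul_one, mul_one] at hd
  have hU0 : Module.finrank ℂ U ≠ 0 := by
    intro h0
    rw [Submodule.finrank_eq_zero] at h0
    apply hz1
    apply hσ
    rw [map_one]
    refine LinearMap.ext fun v => ?_
    obtain ⟨u, hu, l, hl, rfl⟩ := hdec v
    rw [h0, Submodule.mem_bot] at hu
    rw [hu, zero_add]
    exact (memL l).1 hl
  have hU2 : Module.finrank ℂ U = 2 := by
    have hle : Module.finrank ℂ U ≤ 3 := by omega
    generalize Module.finrank ℂ U = d at *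
    interval_cases d
    · exact absurd rfl hU0
    · norm_num at hd
    · rfl
    · norm_num at hd
  have hL1 : Module.finrank ℂ L = 1 := by omega
  have hgU : ∀ g, ∀ v ∈ U, σ g v ∈ U := by
    intro g v hv
    rw [memU] at hv ⊢
    rw [← hcomm, hv, map_neg]
  have hgL : ∀ g, ∀ v ∈ L, σ g v ∈ L := by
    intro g v hv
    rw [memL] at hv ⊢
    rw [← hcomm, hv]
  let σU : G →* Module.End ℂ U :=
    { toFun := fun g => (σ g).restrict (hgU g)
      map_one' := by ext v : 2; simp
      map_mul' := by intro a b; ext v : 2; simp }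
  let σL : G →* Module.End ℂ L :=
    { toFun := fun g => (σ g).restrict (hgL g)
      map_one' := by ext v : 2; simp
      map_mul' := by intro a b; ext v : 2; simp }
  let bU : Module.Basis (Fin 2) ℂ U := Module.finBasisOfFinrankEq ℂ U hU2
  let eU := LinearMap.toMatrixAlgEquiv bU
  refine ⟨MonoidHom.toHomUnits ((eU : Module.End ℂ U →* Matrix (Fin 2) (Fin 2) ℂ).comp σU),
    MonoidHom.toHomUnits ((LinearMap.det (A := ℂ) (M := L)).comp σL), ?_, ?_⟩
  · intro g h1 h2
    have h1' := congrArg Units.val h1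
    have h2' := congrArg Units.val h2
    simp only [MonoidHom.coe_toHomUnits, MonoidHom.comp_apply, Units.val_one] at h1' h2'
    have h1'' : σU g = 1 := by
      apply eU.injective
      rw [map_one]
      exact h1'
    have h2'' : σL g = 1 := by
      obtain ⟨c, hc⟩ : ∃ c : ℂ, σL g = c • LinearMap.id := by
        obtain ⟨c, hc⟩ := (LinearMap.existsUnique_eq_smul_id_of_finrank_eq_one hL1 (σL g)).exists
        exact ⟨c, hc⟩
      rw [hc, LinearMap.det_smul, hL1, LinearMap.det_id, pow_one, mul_one] at h2'
      rw [hc, h2', one_smul]; rfl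
    apply hσ
    rw [map_one]
    refine LinearMap.ext fun v => ?_
    obtain ⟨u, hu, l, hl, rfl⟩ := hdec v
    have a1 := congrArg (fun f : Module.End ℂ U => ((f ⟨u, hu⟩ : U) : Fin 3 → ℂ)) h1''
    have a2 := congrArg (fun f : Module.End ℂ L => ((f ⟨l, hl⟩ : L) : Fin 3 → ℂ)) h2''
    simp [σU] at a1
    simp [σL] at a2
    rw [map_add, a1, a2]; rfl
  · have h3 : σU z = (-1 : ℂ) • 1 := by
      ext v : 2
      have := (memU v).1 v.2
      simp [σU, ← hT, this]
    have : eU (σU z) = -1 := by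
      rw [h3, map_smul, map_one, neg_one_smul]
    exact this


theorem weights {G : Type*} [Group G] [Finite G] (σ : G →* Module.End ℂ (Fin 3 → ℂ))
    (hσ : Function.Injective σ) (N : Subgroup G) [hN : N.Normal]
    (hab : ∀ a ∈ N, ∀ b ∈ N, a * b = b * a)
    (h2 : ∀ g : G, ∃ k : ℕ, ∀ n ∈ N, g ^ 2 ^ k * n = n * g ^ 2 ^ k) :
    ∀ d ∈ commutator G, ∀ n ∈ N, d * n = n * d := by
  have hcm : ∀ a b : N, Commute (σ a) (σ b) := by
    intro a b
    change σ a * σ b = σ b * σ a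
    rw [← map_mul, ← map_mul, hab a a.2 b b.2]
  have hss : ∀ g : G, (σ g).IsSemisimple := by
    intro g
    have ho : orderOf g ≠ 0 := (orderOf_pos g).ne'
    refine Module.End.isSemisimple_of_squarefree_aeval_eq_zero
      (p := (Polynomial.X ^ (orderOf g) - 1 : Polynomial ℂ)) ?_ ?_
    · apply Polynomial.Separable.squarefree
      have := Polynomial.separable_X_pow_sub_C (F := ℂ) (n := orderOf g) 1
        (by exact_mod_cast ho) one_ne_zero
      simpa using this
    · rw [map_sub, map_pow, Polynomial.aeval_X, map_one, ← map_pow, pow_orderOf_eq_one, map_one,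
        sub_self]
  let E : (N → ℂ) → Submodule ℂ (Fin 3 → ℂ) := fun χ => ⨅ n : N, (σ n).eigenspace (χ n)
  have hE : E = fun χ => ⨅ n : N, (σ n).maxGenEigenspace (χ n) := by
    funext χ
    refine iInf_congr fun n => ?_
    rw [(hss n).isFinitelySemisimple.maxGenEigenspace_eq_eigenspace]
  have hind : iSupIndep E := by
    rw [hE]
    exact Module.End.independent_iInf_maxGenEigenspace_of_forall_mapsTo (fun n : N => σ n)
      (fun i j φ => Module.End.mapsTo_maxGenEigenspace_of_comm (hcm j i) φ)
  have htop : ⨆ χ, E χ = ⊤ := by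
    rw [hE]
    exact Module.End.iSup_iInf_maxGenEigenspace_eq_top_of_iSup_maxGenEigenspace_eq_top_of_commute
      (fun n : N => σ n) (fun i j _ => hcm i j)
      (fun i => Module.End.iSup_maxGenEigenspace_eq_top _)
  have memE : ∀ χ v, v ∈ E χ ↔ ∀ n : N, σ n v = χ n • v := by
    intro χ v
    simp only [E, Submodule.mem_iInf, Module.End.mem_eigenspace_iff]
  have hmove : ∀ (g : G) χ v, v ∈ E χ → σ g v ∈ E (fun n => χ (MulAut.conjNormal g⁻¹ n)) := by
    intro g χ v hv
    rw [memE] at hv ⊢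
    intro n
    have h1 := hv (MulAut.conjNormal g⁻¹ n)
    rw [MulAut.conjNormal_apply, inv_inv] at h1
    rw [← map_smul, ← h1, ← Module.End.mul_apply, ← Module.End.mul_apply, ← map_mul, ← map_mul]
    congr 2
    group
  have hmove' : ∀ (g : G) χ, E χ ≠ ⊥ → E (fun n => χ (MulAut.conjNormal g⁻¹ n)) ≠ ⊥ := by
    intro g χ hχ
    obtain ⟨v, hv, hv0⟩ := (Submodule.ne_bot_iff _).1 hχ
    refine (Submodule.ne_bot_iff _).2 ⟨σ g v, hmove g χ v hv, ?_⟩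
    intro h0
    apply hv0
    have : σ g⁻¹ (σ g v) = v := by
      rw [← Module.End.mul_apply, ← map_mul, inv_mul_cancel, map_one]; rfl
    rw [← this, h0, map_zero]
  let X := {χ // E χ ≠ ⊥}
  letI : MulAction G X :=
    { smul := fun g χ => ⟨fun n => χ.1 (MulAut.conjNormal g⁻¹ n), hmove' g χ.1 χ.2⟩
      one_smul := by
        intro χ
        apply Subtype.ext
        funext n
        change χ.1 (MulAut.conjNormal 1⁻¹ n) = χ.1 n
        simp
      mul_smul := by
        intro a b χ
        apply Subtype.ext
        funext n
        change χ.1 (MulAut.conjNormal (a * b)⁻¹ n) =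
          χ.1 (MulAut.conjNormal b⁻¹ (MulAut.conjNormal a⁻¹ n))
        rw [mul_inv_rev, map_mul]; rfl }
  have hsm : ∀ (g : G) (χ : X) (n : N), (g • χ).1 n = χ.1 (MulAut.conjNormal g⁻¹ n) :=
    fun _ _ _ => rfl
  haveI : Fintype X := hind.fintypeNeBotOfFiniteDimensional
  have hX : Fintype.card X ≤ 3 := by
    have := hind.subtype_ne_bot_le_finrank
    rwa [Module.finrank_fin_fun] at this
  let f : G →* Equiv.Perm X := MulAction.toPermHom G X
  have hker : ∀ g, f g = 1 → ∀ n ∈ N, g * n = n * g := by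
    intro g hg n hn
    have hg' : ∀ χ : X, g • χ = χ := fun χ => by
      have := congrArg (fun e : Equiv.Perm X => e χ) hg
      exact this
    have hn' : σ (g⁻¹ * n * g) = σ n := by
      refine LinearMap.ext fun v => ?_
      have hv : v ∈ ⨆ χ, E χ := htop ▸ Submodule.mem_top
      induction hv using Submodule.iSup_induction' with
      | mem χ v hv =>
        by_cases hb : E χ = ⊥
        · rw [hb, Submodule.mem_bot] at hv
          rw [hv, map_zero, map_zero]
        · have h1 := congrArg (fun c : X => c.1 ⟨n, hn⟩) (hg' ⟨χ, hb⟩)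
          simp only [hsm] at h1
          rw [memE] at hv
          have a1 := hv ⟨n, hn⟩
          have a2 := hv (MulAut.conjNormal g⁻¹ ⟨n, hn⟩)
          rw [MulAut.conjNormal_apply, inv_inv] at a2
          rw [a2, a1, h1]
      | zero => rw [map_zero, map_zero]
      | add x y _ _ hx hy => rw [map_add, map_add, hx, hy]
    have := hσ hn'
    calc g * n = g * (g⁻¹ * n * g) := by rw [this]
      _ = n * g := by group
  -- every element of the image has order a power of two
  have hp : IsPGroup 2 f.range := by
    rintro ⟨_, g, rfl⟩
    obtain ⟨k, hk⟩ := h2 g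
    refine ⟨k, ?_⟩
    apply Subtype.ext
    change (f g) ^ 2 ^ k = 1
    rw [← map_pow]
    ext1 χ
    change (g ^ 2 ^ k) • χ = χ
    apply Subtype.ext
    funext n
    rw [hsm]
    refine congrArg χ.1 (Subtype.ext ?_)
    rw [MulAut.conjNormal_apply, inv_inv, mul_assoc, ← hk n n.2]
    group
  haveI : Fact (Nat.Prime 2) := ⟨Nat.prime_two⟩
  obtain ⟨r, hr⟩ := hp.exists_card_eq
  have hdvd : 2 ^ r ∣ 6 := by
    rw [← hr]
    refine (Subgroup.card_subgroup_dvd_card f.range).trans ?_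
    classical
    rw [Nat.card_eq_fintype_card, Fintype.card_perm]
    exact (Nat.factorial_dvd_factorial hX)
  have hr1 : r ≤ 1 := by
    by_contra! hlt
    have : 2 ^ 2 ∣ 6 := (pow_dvd_pow 2 hlt).trans hdvd
    norm_num at this
  have hcomm : ∀ a b : G, f a * f b = f b * f a := by
    have hcyc : IsCyclic f.range := by
      interval_cases r
      · have : Subsingleton f.range := (Nat.card_eq_one_iff_unique.1 (by simpa using hr)).1
        infer_instance
      · exact isCyclic_of_prime_card (p := 2) (by simpa using hr)
    intro a b
    have := hcyc.isMulCommutative.is_comm.comm (⟨f a, a, rfl⟩ : f.range) ⟨f b, b, rfl⟩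
    exact congrArg Subtype.val this
  intro d hd
  apply hker
  have : commutator G ≤ f.ker := by
    rw [commutator_def, Subgroup.commutator_le]
    intro a _ b _
    rw [MonoidHom.mem_ker, commutatorElement_def, map_mul, map_mul, map_mul, hcomm a b, map_inv,
      map_inv]
    group
  exact this hd


theorem central_invol {G : Type*} [Group G] [Finite G] (ρ : G →* GL (Fin 3) ℂ)
    (hρ : Function.Injective ρ)
    (hP : ∀ H : Subgroup G, H ≠ ⊤ → ∃ σ : H →* GL (Fin 2) ℂ, Function.Injective σ)
    (P : Sylow 2 (commutator G)) (hP1 : (P : Subgroup (commutator G)) ≠ ⊥) (hcyc : IsCyclic P) :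
    ∃ z ∈ commutator G, z ≠ 1 ∧ z ^ 2 = 1 ∧ ∀ g, g * z = z * g := by
  have : Fact (Nat.Prime 2) := ⟨Nat.prime_two⟩
  obtain ⟨r, hr⟩ := P.2.exists_card_eq
  change Nat.card P = 2 ^ r at hr
  have hr0 : r ≠ 0 := by
    rintro rfl
    apply hP1
    apply Subgroup.eq_bot_of_card_eq
    simpa using hr
  have h2P : 2 ∣ Nat.card P := hr ▸ dvd_pow_self 2 hr0
  have h2D : 2 ∣ Nat.card (commutator G) := h2P.trans (Subgroup.card_subgroup_dvd_card _)
  have h2G : 2 ∣ Nat.card G := h2D.trans (Subgroup.card_subgroup_dvd_card _)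
  have hmf : (Nat.card (commutator G)).minFac = 2 := (Nat.minFac_eq_two_iff _).2 h2D
  set t := MonoidHom.transferSylow P (hcyc.normalizer_le_centralizer hmf) with ht
  have hker : ¬ 2 ∣ Nat.card t.ker := MonoidHom.not_dvd_card_ker_transferSylow P _
  have hkodd : Odd (Nat.card t.ker) := by
    rw [← Nat.not_even_iff_odd, even_iff_two_dvd]; exact hker
  have hodd1 : ∀ d : commutator G, ∀ m : ℕ, Odd m → d ^ m = 1 → t d = 1 := by
    intro d m hm hd
    have h1 : (t d) ^ m = 1 := by rw [← map_pow, hd, map_one]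
    have h2 : (t d) ^ (2 ^ r) = 1 := by rw [← hr]; exact pow_card_eq_one'
    have hco : Nat.Coprime m (2 ^ r) := Nat.Coprime.pow_right _ hm.coprime_two_right
    rw [← orderOf_eq_one_iff, ← Nat.dvd_one, ← hco]
    exact Nat.dvd_gcd (orderOf_dvd_of_pow_eq_one h1) (orderOf_dvd_of_pow_eq_one h2)
  have hoddsub : ∀ H : Subgroup G, Odd (Nat.card H) → ∀ a ∈ H, ∀ b ∈ H, a * b = b * a := by
    intro H hH a ha b hb
    have hne : H ≠ ⊤ := by
      rintro rfl
      rw [Subgroup.card_top, ← Nat.not_even_iff_odd, even_iff_two_dvd] at hH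
      exact hH h2G
    obtain ⟨σ, hσ⟩ := hP H hne
    exact congrArg Subtype.val (odd_GL2_comm σ hσ hH ⟨a, ha⟩ ⟨b, hb⟩)
  set N : Subgroup G := t.ker.map (commutator G).subtype with hN
  have hNcard : Nat.card N = Nat.card t.ker :=
    Subgroup.card_map_of_injective (Subgroup.subtype_injective _)
  have hNodd : Odd (Nat.card N) := hNcard ▸ hkodd
  have hNn : N.Normal := by
    refine ⟨?_⟩
    rintro _ ⟨d, hd, rfl⟩ g
    refine ⟨MulAut.conjNormal g d, ?_, ?_⟩
    · rw [SetLike.mem_coe, MonoidHom.mem_ker]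
      apply hodd1 _ _ hkodd
      rw [← map_pow]
      have h1 : (⟨d, hd⟩ : t.ker) ^ Nat.card t.ker = 1 := pow_card_eq_one'
      have h2 : d ^ Nat.card t.ker = 1 := congrArg Subtype.val h1
      rw [h2, map_one]
    · simp
  have hNab := hoddsub N hNodd
  have h2k : ∀ g : G, ∃ k : ℕ, ∀ n ∈ N, g ^ 2 ^ k * n = n * g ^ 2 ^ k := by
    intro g
    obtain ⟨k, m, hm, hkm⟩ := Nat.exists_eq_two_pow_mul_odd (orderOf_pos g).ne'
    refine ⟨k, fun n hn => ?_⟩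
    set t0 := g ^ 2 ^ k with ht0
    have ho : t0 ^ m = 1 := by rw [ht0, ← pow_mul, ← hkm, pow_orderOf_eq_one]
    have hc : Odd (Nat.card (Subgroup.zpowers t0)) := by
      rw [Nat.card_zpowers]
      exact Odd.of_dvd_nat hm (orderOf_dvd_of_pow_eq_one ho)
    have hs : Odd (Nat.card (N ⊔ Subgroup.zpowers t0 : Subgroup G)) := by
      rw [← Subgroup.relIndex_bot_left, ← Subgroup.relIndex_mul_relIndex (⊥ : Subgroup G) N
        (N ⊔ Subgroup.zpowers t0) bot_le le_sup_left, Subgroup.relIndex_bot_left]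
      refine hNodd.mul (Odd.of_dvd_nat hc ?_)
      rw [sup_comm, Subgroup.relIndex_sup_right]
      exact Subgroup.relIndex_dvd_card _ _
    exact hoddsub _ hs _ (Subgroup.mem_sup_right (Subgroup.mem_zpowers t0)) _
      (Subgroup.mem_sup_left hn)
  let σ : G →* Module.End ℂ (Fin 3 → ℂ) :=
    ((Matrix.toLinAlgEquiv' : Matrix (Fin 3) (Fin 3) ℂ ≃ₐ[ℂ] _) :
      Matrix (Fin 3) (Fin 3) ℂ →* Module.End ℂ (Fin 3 → ℂ)).comp
      ((Units.coeHom (Matrix (Fin 3) (Fin 3) ℂ)).comp ρ)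
  have hσ : Function.Injective σ := by
    intro a b hab
    apply hρ
    apply Units.ext
    exact Matrix.toLinAlgEquiv'.injective hab
  have hDN := weights σ hσ N hNab h2k
  obtain ⟨z, hz⟩ := exists_prime_orderOf_dvd_card' 2 h2D
  have hz2 : z ^ 2 = 1 := by rw [← hz]; exact pow_orderOf_eq_one z
  have hz1 : z ≠ 1 := by
    rintro rfl
    simp at hz
  obtain ⟨x, hx⟩ := hcyc.exists_generator
  have hxo : orderOf x = 2 ^ r := by
    rw [← hr]; exact orderOf_eq_card_of_forall_mem_zpowers hx
  have htne : ∀ y : commutator G, y ^ 2 = 1 → y ≠ 1 → t y ≠ 1 := by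
    intro y hy2 hy1 hty
    have h1 : (⟨y, hty⟩ : t.ker) ^ Nat.card t.ker = 1 := pow_card_eq_one'
    have h2 : y ^ Nat.card t.ker = 1 := congrArg Subtype.val h1
    apply hy1
    obtain ⟨q, hq⟩ := hkodd
    rw [hq, pow_succ, pow_mul, hy2, one_pow, one_mul] at h2
    exact h2
  have huniq : ∀ y : commutator G, y ^ 2 = 1 → y ≠ 1 → y = z := by
    intro y hy2 hy1
    have e1 := (invol_eq x (t y) r hxo (hx _) (by rw [← map_pow, hy2, map_one])
      (htne y hy2 hy1)).2
    have e2 := (invol_eq x (t z) r hxo (hx _) (by rw [← map_pow, hz2, map_one])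
      (htne z hz2 hz1)).2
    have hn : t (y * z⁻¹) = 1 := by rw [map_mul, map_inv, e1, e2, mul_inv_cancel]
    have hzn : z * (y * z⁻¹) = (y * z⁻¹) * z := by
      have := hDN z z.2 (y * z⁻¹ : commutator G) ⟨y * z⁻¹, hn, rfl⟩
      exact Subtype.ext this
    by_contra hne
    refine htne (y * z⁻¹) ?_ (by rw [Ne, mul_inv_eq_one]; exact hne) hn
    have hcomm : Commute y z := by
      have h3 : z * y * z⁻¹ = y := by rw [mul_assoc, hzn, inv_mul_cancel_right]
      exact (mul_inv_eq_iff_eq_mul.1 h3).symm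
    rw [hcomm.inv_right.mul_pow, hy2, inv_pow, hz2, inv_one, one_mul]
  refine ⟨z, z.2, fun h => hz1 (Subtype.ext h), congrArg Subtype.val hz2, fun g => ?_⟩
  have := huniq (MulAut.conjNormal g z) (by rw [← map_pow, hz2, map_one])
    (by rw [Ne, map_eq_one_iff _ (MulEquiv.injective _)]; exact hz1)
  have h4 := congrArg Subtype.val this
  rw [MulAut.conjNormal_apply] at h4
  exact mul_inv_eq_iff_eq_mul.1 h4


theorem center_scalar {G : Type*} [Group G] (α : G →* GL (Fin 2) ℂ)
    (hnc : ∃ a b, α a * α b ≠ α b * α a) :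
    ∃ ω : Subgroup.center G →* ℂˣ, ∀ g : Subgroup.center G,
      ((α g : GL (Fin 2) ℂ) : Matrix (Fin 2) (Fin 2) ℂ) = Matrix.scalar (Fin 2) (ω g : ℂ) := by
  have hsc : ∀ g : Subgroup.center G, ∃ c : ℂ,
      ((α g : GL (Fin 2) ℂ) : Matrix (Fin 2) (Fin 2) ℂ) = Matrix.scalar (Fin 2) c := by
    intro g
    by_contra! hcon
    obtain ⟨a, b, hab⟩ := hnc
    apply hab
    have hg : ∀ x, ((α g : GL (Fin 2) ℂ) : Matrix (Fin 2) (Fin 2) ℂ) * (α x : GL (Fin 2) ℂ) =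
        (α x : GL (Fin 2) ℂ) * (α g : GL (Fin 2) ℂ) := by
      intro x
      rw [← Units.val_mul, ← Units.val_mul, ← map_mul, ← map_mul,
        Subgroup.mem_center_iff.1 g.2 x]
    apply Units.ext
    exact cent2 _ _ _ hcon (hg a) (hg b)
  have hsc' : ∀ g : Subgroup.center G,
      ((α g : GL (Fin 2) ℂ) : Matrix (Fin 2) (Fin 2) ℂ) =
        Matrix.scalar (Fin 2) (((α g : GL (Fin 2) ℂ) : Matrix (Fin 2) (Fin 2) ℂ) 0 0) := by
    intro g
    obtain ⟨c, hc⟩ := hsc g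
    rw [hc]
    simp
  let ω0 : Subgroup.center G →* ℂ :=
    { toFun := fun g => ((α g : GL (Fin 2) ℂ) : Matrix (Fin 2) (Fin 2) ℂ) 0 0
      map_one' := by simp
      map_mul' := by
        intro a b
        obtain ⟨c, hc⟩ := hsc a
        obtain ⟨d, hd⟩ := hsc b
        rw [Subgroup.coe_mul, map_mul, Units.val_mul, hc, hd, ← map_mul]
        simp }
  exact ⟨MonoidHom.toHomUnits ω0, hsc'⟩

theorem exists_faithful_char {Z : Type*} [Group Z] [Finite Z] (hc : IsCyclic Z) :
    ∃ χ : Z →* ℂˣ, Function.Injective χ := by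
  obtain ⟨g, hg⟩ := hc.exists_generator
  have ho : orderOf g ≠ 0 := (orderOf_pos g).ne'
  have hpr := Complex.isPrimitiveRoot_exp (orderOf g) ho
  set ξ : ℂˣ := (hpr.isUnit ho).unit with hξ
  have hξo : orderOf ξ = orderOf g := by
    rw [← orderOf_units, hξ, IsUnit.unit_spec]
    exact hpr.eq_orderOf.symm
  refine ⟨monoidHomOfForallMemZpowers hg hξo.dvd, ?_⟩
  rw [injective_iff_map_eq_one]
  intro x hx
  obtain ⟨i, rfl⟩ := hg x
  simp only [map_zpow, monoidHomOfForallMemZpowers_apply_gen] at hx ⊢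
  rw [← orderOf_dvd_iff_zpow_eq_one] at hx ⊢
  rwa [hξo] at hx

theorem center_not_cyclic {G : Type*} [Group G] [Finite G] (α : G →* GL (Fin 2) ℂ) (β : G →* ℂˣ)
    (hinj : ∀ g, α g = 1 → β g = 1 → g = 1) (z : G) (hzD : z ∈ commutator G)
    (hz : ∀ g, g * z = z * g) (hz2 : z ^ 2 = 1) (hz1 : z ≠ 1)
    (hαz : ((α z : GL (Fin 2) ℂ) : Matrix (Fin 2) (Fin 2) ℂ) = -1)
    (hnc : ∃ a b, α a * α b ≠ α b * α a)
    (hno : ¬ ∃ ρ : G →* GL (Fin 2) ℂ, Function.Injective ρ) :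
    ¬ IsCyclic (Subgroup.center G) := by
  intro hcyc
  apply hno
  obtain ⟨ω, hω⟩ := center_scalar α hnc
  obtain ⟨χ, hχ⟩ := exists_faithful_char hcyc
  have hcommker : ∀ {A : Type} [CommGroup A] (f : G →* A), ∀ d ∈ commutator G, f d = 1 := by
    intro A _ f d hd
    exact Abelianization.commutator_subset_ker f hd
  have hzc : z ∈ Subgroup.center G := Subgroup.mem_center_iff.2 hz
  have hωz : ω ⟨z, hzc⟩ = -1 := by
    have h1 := hω ⟨z, hzc⟩
    simp only at h1
    rw [hαz] at h1
    have h2 := congrFun (congrFun h1 0) 0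
    apply Units.ext
    simpa using h2.symm
  have hχz : χ ⟨z, hzc⟩ = -1 := by
    have h1 : (χ ⟨z, hzc⟩) ^ 2 = 1 := by
      rw [← map_pow]
      have : (⟨z, hzc⟩ : Subgroup.center G) ^ 2 = 1 := Subtype.ext hz2
      rw [this, map_one]
    have h2 : χ ⟨z, hzc⟩ ≠ 1 := by
      intro h
      rw [← map_one χ] at h
      exact hz1 (congrArg Subtype.val (hχ h))
    have h3 : ((χ ⟨z, hzc⟩ : ℂˣ) : ℂ) ^ 2 = 1 := by
      rw [← Units.val_pow_eq_pow_val, h1, Units.val_one]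
    apply Units.ext
    rcases sq_eq_one_iff.1 h3 with h | h
    · exact absurd (Units.ext h) h2
    · simpa using h
  -- Z ∩ D
  have hZD : ∀ g : Subgroup.center G, (g : G) ∈ commutator G → g = 1 ∨ g = ⟨z, hzc⟩ := by
    intro g hg
    have hd : Matrix.GeneralLinearGroup.det (α g) = 1 :=
      hcommker (Matrix.GeneralLinearGroup.det.comp α) g hg
    have hb : β g = 1 := hcommker β g hg
    have hbz : β z = 1 := hcommker β z hzD
    have hd' := congrArg Units.val hd
    rw [Matrix.GeneralLinearGroup.val_det_apply, hω g] at hd'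
    simp only [Matrix.scalar_apply, Matrix.det_diagonal, Finset.prod_const, Finset.card_univ,
      Fintype.card_fin, Units.val_one] at hd'
    rcases sq_eq_one_iff.1 hd' with h | h
    · left
      apply Subtype.ext
      apply hinj _ _ hb
      apply Units.ext
      rw [hω g, h, map_one, Units.val_one]
    · right
      apply Subtype.ext
      have : (g : G) * z⁻¹ = 1 := by
        apply hinj
        · rw [map_mul, map_inv, mul_inv_eq_one]
          apply Units.ext
          rw [hω g, h, hαz, map_neg, map_one]
        · rw [map_mul, map_inv, hb, hbz, inv_one, mul_one]
      exact mul_inv_eq_one.1 this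
  let f : Subgroup.center G →* Abelianization G :=
    Abelianization.of.comp (Subgroup.center G).subtype
  have hker : f.rangeRestrict.ker ≤ (χ / ω).ker := by
    intro g hg
    rw [MonoidHom.ker_rangeRestrict, MonoidHom.mem_ker] at hg
    have hgD : (g : G) ∈ commutator G := by
      rw [← Abelianization.ker_of]
      exact hg
    rw [MonoidHom.mem_ker, MonoidHom.div_apply]
    rcases hZD g hgD with rfl | rfl
    · simp
    · rw [hχz, hωz, div_self']
  let ψ : f.range →* ℂˣ := f.rangeRestrict.liftOfSurjective f.rangeRestrict_surjective ⟨χ / ω, hker⟩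
  have hψ : ∀ g, ψ (f.rangeRestrict g) = (χ / ω) g :=
    fun g => MonoidHom.liftOfRightInverse_comp_apply _ _ _ ⟨χ / ω, hker⟩ g
  obtain ⟨ν, hν⟩ := MonoidHom.domRestrict_surjective (M := ℂ) f.range ψ
  have hμ : ∀ g : Subgroup.center G, ν (Abelianization.of (g : G)) = χ g / ω g := by
    intro g
    have h1 := hψ g
    rw [← hν] at h1
    exact h1
  let μ : G →* ℂˣ := ν.comp Abelianization.of
  let s : ℂˣ →* GL (Fin 2) ℂ := Units.map (Matrix.scalar (Fin 2) : ℂ →+* _).toMonoidHom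
  have hs : ∀ c A, s c * A = A * s c := by
    intro c A
    apply Units.ext
    exact (Matrix.scalar_commute (c : ℂ) (fun r' => Commute.all _ _) (A : Matrix (Fin 2) (Fin 2) ℂ)).eq
  refine ⟨⟨⟨fun g => s (μ g) * α g, by simp⟩, ?_⟩, ?_⟩
  · intro a b
    simp only [map_mul]
    rw [mul_assoc, mul_assoc]
    congr 1
    rw [← mul_assoc, ← mul_assoc, hs]
  · rw [injective_iff_map_eq_one]
    intro g hg
    change s (μ g) * α g = 1 at hg
    have hαg : α g = (s (μ g))⁻¹ := eq_inv_of_mul_eq_one_right hg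
    have hgc : g ∈ Subgroup.center G := by
      rw [Subgroup.mem_center_iff]
      intro x
      have : x * g * (g * x)⁻¹ = 1 := by
        apply hinj
        · rw [map_mul, map_inv, mul_inv_eq_one, map_mul, map_mul, hαg, ← map_inv, hs]
        · rw [map_mul, map_inv, mul_inv_eq_one, map_mul, map_mul, mul_comm]
      exact mul_inv_eq_one.1 this
    have h1 : s (ω ⟨g, hgc⟩) = α g := by
      apply Units.ext
      exact (hω ⟨g, hgc⟩).symm
    rw [← h1, ← map_mul] at hg
    have h2 : μ g = χ ⟨g, hgc⟩ / ω ⟨g, hgc⟩ := hμ ⟨g, hgc⟩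
    rw [h2, div_mul_cancel] at hg
    have h3 : χ ⟨g, hgc⟩ = 1 := by
      have := congrArg (fun M : GL (Fin 2) ℂ => (M : Matrix (Fin 2) (Fin 2) ℂ) 0 0) hg
      apply Units.ext
      simpa [s] using this
    rw [← map_one χ] at h3
    exact congrArg Subtype.val (hχ h3)


theorem exists_prime_of_not_cyclic {Z : Type*} [CommGroup Z] [Finite Z] (hc : ¬ IsCyclic Z) :
    ∃ p : ℕ, p.Prime ∧ p < Nat.card (powMonoidHom p : Z →* Z).ker := by
  by_contra! hcon
  apply hc
  have hle : ∀ n : ℕ, n ≠ 0 → Nat.card (powMonoidHom n : Z →* Z).ker ≤ n := by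
    intro n
    induction n using Nat.recOnMul with
    | zero => intro h; exact absurd rfl h
    | one =>
      intro _
      have : (powMonoidHom 1 : Z →* Z).ker = ⊥ := by
        rw [eq_bot_iff]
        intro x hx
        rw [MonoidHom.mem_ker, powMonoidHom_apply, pow_one] at hx
        exact hx
      rw [this, Subgroup.card_bot]
    | prime p hp => intro _; exact hcon p hp
    | mul a b iha ihb =>
      intro h0
      have ha := iha (left_ne_zero_of_mul h0)
      have hb := ihb (right_ne_zero_of_mul h0)
      have hbab : (powMonoidHom b : Z →* Z).ker ≤ (powMonoidHom (a * b) : Z →* Z).ker := by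
        intro x hx
        rw [MonoidHom.mem_ker, powMonoidHom_apply] at hx ⊢
        rw [mul_comm, pow_mul, hx, one_pow]
      have hmap : ((powMonoidHom (a * b) : Z →* Z).ker.map (powMonoidHom b : Z →* Z)) ≤
          (powMonoidHom a : Z →* Z).ker := by
        rintro _ ⟨x, hx, rfl⟩
        rw [SetLike.mem_coe, MonoidHom.mem_ker, powMonoidHom_apply] at hx
        rw [MonoidHom.mem_ker, powMonoidHom_apply, powMonoidHom_apply, ← pow_mul, mul_comm, hx]
      rw [← Subgroup.relIndex_bot_left, ← Subgroup.relIndex_mul_relIndex _ _ _ bot_le hbab,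
        Subgroup.relIndex_bot_left, Subgroup.relIndex_ker]
      refine (Nat.mul_le_mul hb ((Subgroup.card_le_of_le hmap).trans ha)).trans ?_
      rw [mul_comm]
  classical
  have : Fintype Z := Fintype.ofFinite Z
  apply isCyclic_of_card_pow_eq_one_le
  intro n hn
  refine le_trans (le_of_eq ?_) (hle n hn.ne')
  exact (Nat.subtype_card _ (fun x => by simp [MonoidHom.mem_ker])).symm

theorem elem_iso {E : Type*} [Group E] [Finite E] (p : ℕ) (hp : p.Prime) (ω β : E →* ℂˣ)
    (hinj : ∀ g, ω g = 1 → β g = 1 → g = 1) (hpow : ∀ g : E, g ^ p = 1) (hcard : p < Nat.card E) :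
    Nonempty (E ≃* Multiplicative (ZMod p) × Multiplicative (ZMod p)) ∧ Nat.card E = p ^ 2 := by
  have : Fact p.Prime := ⟨hp⟩
  have : NeZero p := ⟨hp.ne_zero⟩
  have hrc : Nat.card (rootsOfUnity p ℂ) = p := Complex.card_rootsOfUnity p
  have hmem : ∀ (γ : E →* ℂˣ) g, γ g ∈ rootsOfUnity p ℂ := by
    intro γ g
    rw [mem_rootsOfUnity, ← map_pow, hpow, map_one]
  let θ : E →* rootsOfUnity p ℂ × rootsOfUnity p ℂ :=
    (ω.codRestrict _ (hmem ω)).prod (β.codRestrict _ (hmem β))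
  have hθ : Function.Injective θ := by
    rw [injective_iff_map_eq_one]
    intro g hg
    rw [Prod.ext_iff] at hg
    exact hinj g (congrArg Subtype.val hg.1) (congrArg Subtype.val hg.2)
  have hT : Nat.card (rootsOfUnity p ℂ × rootsOfUnity p ℂ) = p ^ 2 := by
    rw [Nat.card_prod, hrc, pow_two]
  have hdvd : Nat.card E ∣ p ^ 2 := hT ▸ Subgroup.card_dvd_of_injective θ hθ
  obtain ⟨i, hi, hE⟩ := (Nat.dvd_prime_pow hp).1 hdvd
  have hi2 : i = 2 := by
    by_contra hne
    have : i ≤ 1 := by omega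
    have := Nat.pow_le_pow_right hp.pos this
    rw [pow_one] at this
    omega
  subst hi2
  refine ⟨?_, hE⟩
  have hbij : Function.Bijective θ :=
    (Nat.bijective_iff_injective_and_card θ).2 ⟨hθ, by rw [hE, hT]⟩
  have e : rootsOfUnity p ℂ ≃* Multiplicative (ZMod p) :=
    mulEquivOfPrimeCardEq (p := p) hrc (by simp)
  exact ⟨(MulEquiv.ofBijective θ hbij).trans (e.prodCongr e)⟩

theorem center_char {K : Type*} [Group K] (σ : K →* GL (Fin 2) ℂ) (hσ : Function.Injective σ)
    (hnc : ∃ a b : K, a * b ≠ b * a) :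
    ∃ ω : Subgroup.center K →* ℂˣ, Function.Injective ω := by
  obtain ⟨a, b, hab⟩ := hnc
  obtain ⟨ω, hω⟩ := center_scalar σ ⟨a, b, fun h => hab (hσ (by rw [map_mul, map_mul, h]))⟩
  refine ⟨ω, fun x y hxy => ?_⟩
  apply Subtype.ext
  apply hσ
  apply Units.ext
  rw [hω, hω, hxy]

theorem card_le_of_char {E : Type*} [Group E] (p : ℕ) (hp : p.Prime) (ω : E →* ℂˣ)
    (hinj : Function.Injective ω) (hpow : ∀ g : E, g ^ p = 1) : Nat.card E ≤ p := by
  have : NeZero p := ⟨hp.ne_zero⟩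
  have hmem : ∀ g, ω g ∈ rootsOfUnity p ℂ := by
    intro g
    rw [mem_rootsOfUnity, ← map_pow, hpow, map_one]
  rw [← Complex.card_rootsOfUnity p]
  refine Nat.card_le_card_of_injective (ω.codRestrict _ hmem) ?_
  intro a b hab
  exact hinj (congrArg Subtype.val hab)

theorem sylow_nonab {G : Type*} [Group G] [Finite G] (z : G) (hzD : z ∈ commutator G)
    (hz : ∀ g, g * z = z * g) (hz2 : z ^ 2 = 1) (hz1 : z ≠ 1) (S : Sylow 2 G) :
    ∃ a b : (S : Subgroup G), a * b ≠ b * a := by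
  by_contra! hcon
  have : Fact (Nat.Prime 2) := ⟨Nat.prime_two⟩
  letI : CommGroup (S : Subgroup G) := { (inferInstance : Group (S : Subgroup G)) with mul_comm := hcon }
  have key : ∀ (k : ℕ) (g₀ : G), g₀⁻¹ * z ^ k * g₀ ∈ (S : Subgroup G) →
      g₀⁻¹ * z ^ k * g₀ = z ^ k := by
    intro k g₀ _
    have h1 : Commute g₀ (z ^ k) := Commute.pow_right (hz g₀) k
    rw [mul_assoc, ← h1.eq, inv_mul_cancel_left]
  have h1 := MonoidHom.transfer_eq_pow (MonoidHom.id (S : Subgroup G)) z key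
  have h2 : MonoidHom.transfer (MonoidHom.id (S : Subgroup G)) z = 1 :=
    Abelianization.commutator_subset_ker _ hzD
  rw [h2] at h1
  have h3 : z ^ (S : Subgroup G).index = 1 := (congrArg Subtype.val h1).symm
  have h4 := S.not_dvd_index
  apply hz1
  obtain ⟨q, hq⟩ : Odd (S : Subgroup G).index := by
    rw [← Nat.not_even_iff_odd, even_iff_two_dvd]; exact h4
  rw [hq, pow_succ, pow_mul, hz2, one_pow, one_mul] at h3
  exact h3


theorem stmt_13 (G : Type*) [Group G] [Finite G]
    (hna : ¬ ∀ a b : G, a * b = b * a) (h : MinFaithful G 3)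
    (hsyl : ∀ P : Sylow 2 (commutator G), (P : Subgroup (commutator G)) ≠ ⊥ ∧ IsCyclic P) :
    IsPGroup 2 G ∨
    (∃ p : ℕ, p.Prime ∧ Odd p ∧
      Nonempty (G ≃* (QuaternionGroup 2 ×
        Multiplicative (ZMod p) × Multiplicative (ZMod p)))) ∨
    (∃ p k : ℕ, p.Prime ∧ Odd p ∧ 2 ≤ k ∧
      ∃ φ : Multiplicative (ZMod 2) →* MulAut (Multiplicative (ZMod (2 ^ k))),
        (∀ g : Multiplicative (ZMod (2 ^ k)),
          φ (Multiplicative.ofAdd 1) g = g ^ (1 + 2 ^ (k - 1))) ∧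
        Nonempty (G ≃* ((Multiplicative (ZMod (2 ^ k)) ⋊[φ] Multiplicative (ZMod 2)) ×
          Multiplicative (ZMod p) × Multiplicative (ZMod p)))) := by
  have : Fact (Nat.Prime 2) := ⟨Nat.prime_two⟩
  push Not at hna
  obtain ⟨⟨ρ, hρ⟩, hno⟩ := rdim_ge3 h.1
  have hP : ∀ H : Subgroup G, H ≠ ⊤ → ∃ σ : H →* GL (Fin 2) ℂ, Function.Injective σ := by
    intro H hH
    exact rdim_lt3 (ρ.comp H.subtype) (hρ.comp H.subtype_injective) (h.2 H hH)
  obtain ⟨z, hzD, hz1, hz2, hz⟩ := central_invol ρ hρ hP default (hsyl default).1 (hsyl default).2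
  let σ : G →* Module.End ℂ (Fin 3 → ℂ) :=
    ((Matrix.toLinAlgEquiv' : Matrix (Fin 3) (Fin 3) ℂ ≃ₐ[ℂ] _) :
      Matrix (Fin 3) (Fin 3) ℂ →* Module.End ℂ (Fin 3 → ℂ)).comp
      ((Units.coeHom (Matrix (Fin 3) (Fin 3) ℂ)).comp ρ)
  have hσ : Function.Injective σ := by
    intro a b hab
    apply hρ
    apply Units.ext
    exact Matrix.toLinAlgEquiv'.injective hab
  have hdet : LinearMap.det (σ z) = 1 := by
    have h1 : Matrix.GeneralLinearGroup.det (ρ z) = 1 :=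
      Abelianization.commutator_subset_ker (Matrix.GeneralLinearGroup.det.comp ρ) hzD
    have h2 := congrArg Units.val h1
    rw [Matrix.GeneralLinearGroup.val_det_apply, Units.val_one] at h2
    rw [← h2]
    exact LinearMap.det_toLin' _
  obtain ⟨α, β, hinj, hαz⟩ := split_rep σ hσ z hz hz2 hz1 hdet
  have hnc : ∃ a b, α a * α b ≠ α b * α a := by
    obtain ⟨a, b, hab⟩ := hna
    refine ⟨a, b, fun hcm => hab ?_⟩
    have : a * b * (b * a)⁻¹ = 1 := by
      apply hinj
      · rw [map_mul, map_inv, mul_inv_eq_one, map_mul, map_mul, hcm]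
      · rw [map_mul, map_inv, mul_inv_eq_one, map_mul, map_mul, mul_comm]
    exact mul_inv_eq_one.1 this
  have hncyc := center_not_cyclic α β hinj z hzD hz hz2 hz1 hαz hnc hno
  letI : CommGroup (Subgroup.center G) :=
    { (inferInstance : Group (Subgroup.center G)) with
      mul_comm := fun x y => Subtype.ext (Subgroup.mem_center_iff.1 y.2 x) }
  obtain ⟨p, hp, hpc⟩ := exists_prime_of_not_cyclic (Z := Subgroup.center G) hncyc
  obtain ⟨ω, hω⟩ := center_scalar α hnc
  obtain ⟨E, hEc, hEp, hEcard⟩ : ∃ E : Subgroup G, (∀ g ∈ E, g ∈ Subgroup.center G) ∧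
      (∀ g : E, g ^ p = 1) ∧ p < Nat.card E := by
    refine ⟨(powMonoidHom p : Subgroup.center G →* Subgroup.center G).ker.map
      (Subgroup.center G).subtype, ?_, ?_, ?_⟩
    · rintro _ ⟨x, _, rfl⟩
      exact x.2
    · rintro ⟨_, x, hx, rfl⟩
      rw [SetLike.mem_coe, MonoidHom.mem_ker, powMonoidHom_apply] at hx
      have h5 : ((x ^ p : Subgroup.center G) : G) = ((1 : Subgroup.center G) : G) := congrArg Subtype.val hx
      apply Subtype.ext
      rw [Subgroup.coe_pow, Subgroup.coe_one]
      exact h5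
    · rwa [Subgroup.card_map_of_injective (Subgroup.subtype_injective _)]
  have hEn : E.Normal := ⟨fun n hn g => by
    rw [Subgroup.mem_center_iff.1 (hEc n hn) g, mul_inv_cancel_right]; exact hn⟩
  obtain ⟨⟨eE⟩, hEsq⟩ := elem_iso p hp (ω.comp (Subgroup.inclusion hEc)) (β.comp E.subtype) (by
    intro g h1 h2
    apply Subtype.ext
    refine hinj g ?_ h2
    apply Units.ext
    have h3 := hω (Subgroup.inclusion hEc g)
    have h4 : ω (Subgroup.inclusion hEc g) = 1 := h1
    rw [h4, Units.val_one, map_one] at h3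
    exact h3) hEp hEcard
  have hB : ∀ B : Subgroup G, (∃ a ∈ B, ∃ b ∈ B, a * b ≠ b * a) → B ⊔ E = ⊤ := by
    rintro B ⟨a, ha, b, hb, hab⟩
    by_contra hne
    obtain ⟨τ, hτ⟩ := hP _ hne
    obtain ⟨κ, hκ⟩ := center_char τ hτ ⟨⟨a, Subgroup.mem_sup_left ha⟩,
      ⟨b, Subgroup.mem_sup_left hb⟩, fun hcm => hab (congrArg Subtype.val hcm)⟩
    let j : E →* Subgroup.center (B ⊔ E : Subgroup G) :=
      (Subgroup.inclusion (le_sup_right : E ≤ B ⊔ E)).codRestrict _ (by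
        intro g
        rw [Subgroup.mem_center_iff]
        intro x
        exact Subtype.ext (Subgroup.mem_center_iff.1 (hEc g g.2) x))
    have hj : Function.Injective j := by
      intro x y hxy
      have := congrArg (fun w : Subgroup.center (B ⊔ E : Subgroup G) => ((w : (B ⊔ E : Subgroup G)) : G)) hxy
      exact Subtype.ext this
    have := card_le_of_char p hp (κ.comp j) (hκ.comp hj) hEp
    omega
  let S : Sylow 2 G := default
  obtain ⟨a, b, hab⟩ := sylow_nonab z hzD hz hz2 hz1 S
  have hSE := hB S ⟨a, a.2, b, b.2, fun hcm => hab (Subtype.ext hcm)⟩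
  rcases hp.eq_two_or_odd' with rfl | hodd
  · left
    have hE2 : IsPGroup 2 E := fun g => ⟨1, by rw [pow_one]; exact hEp g⟩
    have h1 : IsPGroup 2 ((S : Subgroup G) ⊔ E : Subgroup G) := IsPGroup.to_sup_of_normal_right S.2 hE2
    rw [hSE] at h1
    exact h1.of_equiv Subgroup.topEquiv
  right
  obtain ⟨n, hn⟩ := S.2.exists_card_eq
  change Nat.card (S : Subgroup G) = 2 ^ n at hn
  have hdisj : Disjoint (S : Subgroup G) E := by
    apply Subgroup.disjoint_of_coprime_natCard
    rw [hn, hEsq]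
    exact Nat.Coprime.pow _ _ hodd.coprime_two_left
  have hdis' : ∀ x ∈ (S : Subgroup G), x ∈ E → x = 1 := fun x h1 h2 =>
    Subgroup.disjoint_def.1 hdisj h1 h2
  have hmin : ∀ K : Subgroup (S : Subgroup G), (∃ a ∈ K, ∃ b ∈ K, a * b ≠ b * a) → K = ⊤ := by
    rintro K ⟨a, ha, b, hb, hab⟩
    have h1 := hB (K.map (S : Subgroup G).subtype) ⟨a, ⟨a, ha, rfl⟩, b, ⟨b, hb, rfl⟩,
      fun hcm => hab (Subtype.ext hcm)⟩
    rw [eq_top_iff]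
    intro s _
    have hs : (s : G) ∈ K.map (S : Subgroup G).subtype ⊔ E := h1 ▸ Subgroup.mem_top _
    rw [Subgroup.mem_sup_of_normal_right] at hs
    obtain ⟨_, ⟨x, hx, rfl⟩, e, he, hxe⟩ := hs
    have he1 : e = 1 := by
      apply hdis' e _ he
      have : e = (x : G)⁻¹ * s := by rw [← hxe]; simp
      rw [this]
      exact mul_mem (inv_mem x.2) s.2
    rw [he1, mul_one] at hxe
    have : x = s := Subtype.ext hxe
    rwa [← this]
  have hSne : (S : Subgroup G) ≠ ⊤ := by
    intro htop
    have hE1 : E = ⊥ := by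
      rw [eq_bot_iff]
      intro x hx
      exact hdis' x (htop ▸ Subgroup.mem_top x) hx
    rw [hE1, Subgroup.card_bot] at hEcard
    have := hp.two_le
    omega
  obtain ⟨τ, hτ⟩ := hP _ hSne
  obtain ⟨κ, hκ⟩ := center_char τ hτ ⟨a, b, hab⟩
  have hScyc : IsCyclic (Subgroup.center (S : Subgroup G)) :=
    isCyclic_of_subgroup_isDomain ((Units.coeHom ℂ).comp κ) (Units.val_injective.comp hκ)
  have hSiso := minnonab S.2 ⟨a, b, hab⟩ hmin hScyc
  have hcomm : ∀ (s : (S : Subgroup G)) (e : E), Commute ((S : Subgroup G).subtype s) (E.subtype e) :=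
    fun s e => Subgroup.mem_center_iff.1 (hEc e e.2) s
  let F := MonoidHom.noncommCoprod (S : Subgroup G).subtype E.subtype hcomm
  have hF : Function.Bijective F := by
    refine ⟨?_, ?_⟩
    · rw [MonoidHom.noncommCoprod_injective]
      refine ⟨Subgroup.subtype_injective _, Subgroup.subtype_injective _, ?_⟩
      rwa [Subgroup.range_subtype, Subgroup.range_subtype]
    · rw [← MonoidHom.range_eq_top, MonoidHom.noncommCoprod_range, Subgroup.range_subtype,
        Subgroup.range_subtype, hSE]
  let eG : G ≃* Prod (S : Subgroup G) E := (MulEquiv.ofBijective F hF).symm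
  rcases hSiso with ⟨⟨e⟩⟩ | ⟨k, hk, φ, hφ, ⟨e⟩⟩
  · left
    exact ⟨p, hp, hodd, ⟨eG.trans (e.prodCongr eE)⟩⟩
  · right
    exact ⟨p, k, hp, hodd, hk, φ, hφ, ⟨eG.trans (e.prodCongr eE)⟩⟩
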